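/- Let X be a separable Hilbert space with X = Y ⊕ Z as in the setup, and let φ ∈ C¹(X, ℝ) be an even functional such that ∇φ is weakly sequentially continuous and φ satisfies the (PS)^c condition for every c < ∞ (every sequence {u_n} with sup_n φ(u_n) ≤ c and φ'(u_n) → 0 in X' has a convergent subsequence). Suppose that for every k ∈ ℕ there exist ρ_k > r_k > 0 such that: (A₁) d_k := sup{φ(u) : u ∈ Y_k, ‖u‖ ≤ ρ_k} < ∞; (A₂)' a_k := sup{φ(u) : u ∈ Y_k, ‖u‖ = ρ_k} < inf{φ(u) : u ∈ Z_k, ‖u‖ ≤ r_k}; (A₃) b_k := inf{φ(u) : u ∈ Z_k, ‖u‖ = r_k} → ∞ as k → ∞; and (A₄) for every δ > 0 there is C_δ < ∞ with sup{φ(u) : ‖u‖_τ < δ} ≤ C_δ. Then φ has a sequence of critical points {u^{k_m}} with ‖u^{k_m}‖ → ∞ as m → ∞. -/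

import Mathlib

open Filter Topology Metric Set
open scoped RealInnerProductSpace

noncomputable section

/-- The setup of the fountain theorem: a separable Hilbert space `X = Y ⊕ Z`,
where `Y` is a closed subspace with orthonormal (topological) basis `e`,
`Z = Yᗮ` has orthonormal (topological) basis `f`, and `P`, `Q` are the
orthogonal projections onto `Y` and `Z` respectively. -/
structure FountainSetup (X : Type*) [NormedAddCommGroup X] [InnerProductSpace ℝ X]
    [CompleteSpace X] : Type _ where
  separable : TopologicalSpace.SeparableSpace X
  Y : Submodule ℝ X
  closedY : IsClosed (Y : Set X)
  e : ℕ → X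
  f : ℕ → X
  orth_e : Orthonormal ℝ e
  orth_f : Orthonormal ℝ f
  e_mem : ∀ j, e j ∈ Y
  f_mem : ∀ j, f j ∈ Yᗮ
  span_e : (Submodule.span ℝ (Set.range e)).topologicalClosure = Y
  span_f : (Submodule.span ℝ (Set.range f)).topologicalClosure = Yᗮ
  P : X →L[ℝ] X
  Q : X →L[ℝ] X
  P_mem : ∀ u, P u ∈ Y
  Q_mem : ∀ u, Q u ∈ Yᗮ
  P_add_Q : ∀ u, P u + Q u = u

namespace FountainSetup

variable {X : Type*} [NormedAddCommGroup X] [InnerProductSpace ℝ X] [CompleteSpace X]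
variable (S : FountainSetup X)

/-- `Y_k = Y ⊕ (⊕_{j=0}^{k} ℝ f_j)`. -/
def Yk (k : ℕ) : Submodule ℝ X := S.Y ⊔ Submodule.span ℝ (S.f '' {j | j ≤ k})

/-- `Z_k` = closure of `⊕_{j=k}^{∞} ℝ f_j`. -/
def Zk (k : ℕ) : Submodule ℝ X :=
  (Submodule.span ℝ (S.f '' {j | k ≤ j})).topologicalClosure

/-- The τ-norm `‖u‖_τ = max { Σ_j 2^{-(j+1)} |⟨Pu, e_j⟩| , ‖Qu‖ }`. -/
def tauNorm (u : X) : ℝ :=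
  max (∑' j : ℕ, (1 / 2 : ℝ) ^ (j + 1) * |⟪S.P u, S.e j⟫|) ‖S.Q u‖

/-- Convergence of a sequence in the τ-topology (which is induced by the norm `tauNorm`,
hence metrizable, so sequential convergence describes it completely). -/
def TauTendsto (u : ℕ → X) (v : X) : Prop :=
  Tendsto (fun n => S.tauNorm (u n - v)) atTop (𝓝 0)

end FountainSetup

/-- Weak convergence of a sequence in a Hilbert space. -/
def WeakConv {X : Type*} [NormedAddCommGroup X] [InnerProductSpace ℝ X]
    (u : ℕ → X) (v : X) : Prop :=
  ∀ w : X, Tendsto (fun n => ⟪u n, w⟫) atTop (𝓝 ⟪v, w⟫)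

/-- `∇φ` is weakly sequentially continuous: `φ'(u_n) v → φ'(u) v` for all `v`
whenever `u_n ⇀ u` weakly. -/
def WeaklySeqContDeriv {X : Type*} [NormedAddCommGroup X] [InnerProductSpace ℝ X]
    (φ' : X → X →L[ℝ] ℝ) : Prop :=
  ∀ (u : ℕ → X) (v : X), WeakConv u v →
    ∀ w : X, Tendsto (fun n => φ' (u n) w) atTop (𝓝 (φ' v w))

theorem four_dvd_card_of_commuting_involutions {α : Type*} (a b : α → α) (E : Finset α)
    (ha : ∀ x ∈ E, a x ∈ E) (hb : ∀ x ∈ E, b x ∈ E) (haa : ∀ x ∈ E, a (a x) = x)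
    (hbb : ∀ x ∈ E, b (b x) = x) (hab : ∀ x ∈ E, a (b x) = b (a x))
    (ha' : ∀ x ∈ E, a x ≠ x) (hb' : ∀ x ∈ E, b x ≠ x) (hab' : ∀ x ∈ E, a (b x) ≠ x) :
    4 ∣ E.card := by
  classical
  induction E using Finset.strongInduction with
  | H E ih =>
    rcases E.eq_empty_or_nonempty with rfl | ⟨x, hx⟩
    · simp
    set T : Finset α := {x, a x, b x, a (b x)} with hT
    have hTE : T ⊆ E := by
      intro y hy
      simp only [hT, Finset.mem_insert, Finset.mem_singleton] at hy
      rcases hy with rfl | rfl | rfl | rfl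
      · exact hx
      · exact ha _ hx
      · exact hb _ hx
      · exact ha _ (hb _ hx)
    have hTa : ∀ y ∈ E, a y ∈ T → y ∈ T := by
      intro y hy h
      have := haa y hy
      simp only [hT, Finset.mem_insert, Finset.mem_singleton] at h ⊢
      rcases h with h | h | h | h <;> rw [h] at this
      · simp [← this]
      · rw [haa x hx] at this; simp [← this]
      · simp [← this]
      · rw [haa _ (hb x hx)] at this; simp [← this]
    have hTb : ∀ y ∈ E, b y ∈ T → y ∈ T := by
      intro y hy h
      have := hbb y hy
      simp only [hT, Finset.mem_insert, Finset.mem_singleton] at h ⊢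
      rcases h with h | h | h | h <;> rw [h] at this
      · simp [← this]
      · rw [← hab x hx] at this; simp [← this]
      · rw [hbb x hx] at this; simp [← this]
      · rw [hab x hx, hbb _ (ha x hx)] at this; simp [← this]
    have hcard : T.card = 4 := by
      have h1 : x ∉ ({a x, b x, a (b x)} : Finset α) := by
        simp [(ha' x hx).symm, (hb' x hx).symm, (hab' x hx).symm]
      have h2 : a x ∉ ({b x, a (b x)} : Finset α) := by
        simp only [Finset.mem_insert, Finset.mem_singleton, not_or]
        refine ⟨fun h => hab' x hx ?_, fun h => hb' x hx ?_⟩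
        · rw [← h, haa x hx]
        · have := congrArg a h
          rw [haa x hx, haa _ (hb x hx)] at this
          exact this.symm
      have h3 : b x ∉ ({a (b x)} : Finset α) := by
        simpa using (ha' _ (hb x hx)).symm
      rw [hT, Finset.card_insert_of_notMem h1, Finset.card_insert_of_notMem h2,
        Finset.card_insert_of_notMem h3, Finset.card_singleton]
    have hsub : E \ T ⊂ E := Finset.sdiff_ssubset hTE ⟨x, by simp [hT]⟩
    have := ih (E \ T) hsub
      (fun y hy => by
        rw [Finset.mem_sdiff] at hy ⊢
        exact ⟨ha y hy.1, fun h => hy.2 (hTa y hy.1 h)⟩)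
      (fun y hy => by
        rw [Finset.mem_sdiff] at hy ⊢
        exact ⟨hb y hy.1, fun h => hy.2 (hTb y hy.1 h)⟩)
      (fun y hy => haa y (Finset.mem_sdiff.1 hy).1) (fun y hy => hbb y (Finset.mem_sdiff.1 hy).1)
      (fun y hy => hab y (Finset.mem_sdiff.1 hy).1) (fun y hy => ha' y (Finset.mem_sdiff.1 hy).1)
      (fun y hy => hb' y (Finset.mem_sdiff.1 hy).1) (fun y hy => hab' y (Finset.mem_sdiff.1 hy).1)
    rw [← Finset.card_sdiff_add_card_eq_card hTE, hcard]
    exact dvd_add this (dvd_refl 4)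

/-- The edge directions of the Freudenthal triangulation: `-(1, …, 1)` and the unit vectors. -/
def latticeStep (n : ℕ) : Fin (n + 2) → Fin (n + 1) → ℤ :=
  Fin.cons (fun _ => -1) (fun l => Pi.single l 1)

/-- The vertices of a top-dimensional simplex of the Freudenthal triangulation of `ℝⁿ⁺¹`,
listed in cyclic order starting from an arbitrary vertex. -/
def IsCellWith {n : ℕ} (σ : Equiv.Perm (Fin (n + 2))) (s : Fin (n + 2) → Fin (n + 1) → ℤ) : Prop :=
  ∀ i, s (i + 1) - s i = latticeStep n (σ i)

/-- `s` lists the vertices of a top-dimensional simplex of the Freudenthal triangulation. -/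
def IsCell {n : ℕ} (s : Fin (n + 2) → Fin (n + 1) → ℤ) : Prop := ∃ σ, IsCellWith σ s

/-- Replace the vertex with index `0` by its mirror image, keeping the opposite facet. -/
def cellPivot {n : ℕ} (s : Fin (n + 2) → Fin (n + 1) → ℤ) : Fin (n + 2) → Fin (n + 1) → ℤ :=
  Function.update s 0 (s (-1) + s 1 - s 0)

/-- The antipodal simplex. -/
def cellNeg {n : ℕ} (s : Fin (n + 2) → Fin (n + 1) → ℤ) : Fin (n + 2) → Fin (n + 1) → ℤ :=
  fun i => -s (-i)

/-- Renumber the vertices cyclically. -/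
def cellRotate {n : ℕ} (k : Fin (n + 2)) (s : Fin (n + 2) → Fin (n + 1) → ℤ) :
    Fin (n + 2) → Fin (n + 1) → ℤ :=
  fun i => s (i + k)

section Cells

variable {n : ℕ} {s : Fin (n + 2) → Fin (n + 1) → ℤ}

theorem latticeStep_apply (j : Fin (n + 2)) (l : Fin (n + 1)) :
    latticeStep n j l = (if j = l.succ then 1 else 0) - if j = 0 then 1 else 0 := by
  refine Fin.cases ?_ (fun i => ?_) j
  · simp [latticeStep, (Fin.succ_ne_zero l).symm]
  · simp [latticeStep, Pi.single_apply, Fin.succ_ne_zero, eq_comm]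

theorem latticeStep_injective : Function.Injective (latticeStep n) := by
  intro i j h
  have key : ∀ i j : Fin (n + 2), latticeStep n i = latticeStep n j → i = 0 → j = 0 := by
    intro i j h hi
    by_contra hj
    have := congrFun h 0
    rw [latticeStep_apply, latticeStep_apply] at this
    subst hi
    simp only [hj, if_true, if_false, (Fin.succ_ne_zero (0 : Fin (n + 1))).symm] at this
    split_ifs at this <;> omega
  by_cases hi : i = 0
  · rw [hi, key i j h hi]
  · obtain ⟨l, rfl⟩ := Fin.exists_succ_eq.2 hi
    have hj : j ≠ 0 := fun hj => hi (key j _ h.symm hj)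
    have := congrFun h l
    rw [latticeStep_apply, latticeStep_apply] at this
    by_contra hne
    simp [hi, hj, Ne.symm hne] at this

theorem cellPivot_zero : cellPivot s 0 = s (-1) + s 1 - s 0 := by simp [cellPivot]

theorem cellPivot_of_ne {i : Fin (n + 2)} (h : i ≠ 0) : cellPivot s i = s i := by
  simp [cellPivot, h]

theorem fin_neg_one_ne_zero : (-1 : Fin (n + 2)) ≠ 0 := neg_ne_zero.2 one_ne_zero

theorem cellPivot_cellPivot : cellPivot (cellPivot s) = s := by
  ext i : 1
  by_cases h : i = 0
  · subst h
    rw [cellPivot_zero, cellPivot_zero, cellPivot_of_ne fin_neg_one_ne_zero,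
      cellPivot_of_ne one_ne_zero]
    abel
  · rw [cellPivot_of_ne h, cellPivot_of_ne h]

theorem cellNeg_cellNeg : cellNeg (cellNeg s) = s := by
  ext i : 1
  simp [cellNeg]

theorem cellPivot_cellNeg : cellPivot (cellNeg s) = cellNeg (cellPivot s) := by
  ext i : 1
  by_cases h : i = 0
  · subst h
    rw [cellPivot_zero]
    simp only [cellNeg, neg_neg, neg_zero, cellPivot_zero]
    abel
  · rw [cellPivot_of_ne h]
    simp only [cellNeg]
    rw [cellPivot_of_ne (neg_ne_zero.2 h)]

theorem IsCellWith.neg {σ : Equiv.Perm (Fin (n + 2))} (h : IsCellWith σ s) :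
    IsCellWith (Fin.revPerm.trans σ) (cellNeg s) := by
  intro i
  have h1 := h (-(i + 1))
  have h2 : -(i + 1) + 1 = -i := by abel
  have h3 : -(i + 1) = Fin.rev i := by
    rw [neg_eq_iff_add_eq_zero]
    ext
    have h4 := i.2
    have h5 : i.val + 1 + (n + 1 - i.val) = n + 2 := by omega
    simp [Fin.val_add, Fin.val_rev, h5]
  rw [h2] at h1
  simp only [cellNeg, Equiv.trans_apply, Fin.revPerm_apply, ← h3, ← h1]
  abel

theorem IsCell.neg (h : IsCell s) : IsCell (cellNeg s) := by
  obtain ⟨σ, hσ⟩ := h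
  exact ⟨_, hσ.neg⟩

theorem IsCell.rotate (h : IsCell s) (k : Fin (n + 2)) : IsCell (cellRotate k s) := by
  obtain ⟨σ, hσ⟩ := h
  refine ⟨(Equiv.addRight k).trans σ, fun i => ?_⟩
  have := hσ (i + k)
  simp only [cellRotate, Equiv.trans_apply, Equiv.coe_addRight]
  rw [← this, add_right_comm]

theorem IsCell.pivot (h : IsCell s) : IsCell (cellPivot s) := by
  obtain ⟨σ, hσ⟩ := h
  refine ⟨(Equiv.swap (-1) 0).trans σ, fun i => ?_⟩
  have h0 := hσ 0
  have h1 := hσ (-1)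
  rw [zero_add] at h0
  rw [neg_add_cancel] at h1
  simp only [Equiv.trans_apply]
  by_cases hi : i = 0
  · subst hi
    rw [zero_add, Equiv.swap_apply_right, ← h1, cellPivot_zero, cellPivot_of_ne one_ne_zero]
    abel
  by_cases hi' : i = -1
  · subst hi'
    rw [neg_add_cancel, Equiv.swap_apply_left, ← h0, cellPivot_zero,
      cellPivot_of_ne fin_neg_one_ne_zero]
    abel
  · rw [Equiv.swap_apply_of_ne_of_ne hi' hi, ← hσ i, cellPivot_of_ne hi,
      cellPivot_of_ne (fun h => hi' (eq_neg_of_add_eq_zero_left h))]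

/-- Along a suitable cyclic numbering each coordinate of the vertices of a cell is a step
function. -/
theorem IsCell.exists_order (h : IsCell s) : ∃ (b : Fin (n + 2)) (p : Fin (n + 1) → Fin (n + 2)),
    (∀ l t, s (b + t) l = s b l + if p l < t then 1 else 0) ∧
      ∀ t, t ≠ Fin.last (n + 1) → ∃ l, p l = t := by
  obtain ⟨σ, hσ⟩ := h
  refine ⟨σ.symm 0 + 1, fun l => σ.symm l.succ - (σ.symm 0 + 1), fun l t => ?_, fun t ht => ?_⟩
  · induction t using Fin.induction with
    | zero => simp
    | succ t ih =>
      have h1 := congrFun (hσ (σ.symm 0 + 1 + t.castSucc)) l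
      rw [add_assoc, Fin.coeSucc_eq_succ, Pi.sub_apply, latticeStep_apply] at h1
      have h2 : σ (σ.symm 0 + 1 + t.castSucc) ≠ 0 := by
        intro h
        rw [← Equiv.eq_symm_apply, add_assoc, add_eq_left, add_comm (1 : Fin (n + 2)) t.castSucc,
          Fin.coeSucc_eq_succ] at h
        exact Fin.succ_ne_zero _ h
      have h3 : σ (σ.symm 0 + 1 + t.castSucc) = l.succ ↔
          σ.symm l.succ - (σ.symm 0 + 1) = t.castSucc := by
        rw [← Equiv.eq_symm_apply, sub_eq_iff_eq_add', eq_comm]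
      simp only [h2, if_false, h3] at h1
      rw [eq_add_of_sub_eq h1, ih]
      rcases lt_trichotomy (σ.symm l.succ - (σ.symm 0 + 1)) t.castSucc with h | h | h
      · simp [h, h.ne, h.trans (Fin.castSucc_lt_succ (i := t))]
      · simp only [h, lt_irrefl, Fin.castSucc_lt_succ, if_true, if_false]
        ring
      · have : ¬ (σ.symm l.succ - (σ.symm 0 + 1)) < t.succ := by
          rw [not_lt]; exact Fin.castSucc_lt_iff_succ_le.1 h
        simp [this, h.not_gt, h.ne']
  · have h2 : σ (σ.symm 0 + 1 + t) ≠ 0 := by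
      intro h
      rw [← Equiv.eq_symm_apply, add_assoc, add_eq_left, add_comm (1 : Fin (n + 2)) t] at h
      apply ht
      rw [eq_neg_of_add_eq_zero_left h, eq_comm, ← add_eq_zero_iff_eq_neg, Fin.last_add_one]
    obtain ⟨l, hl⟩ := Fin.exists_succ_eq.2 h2
    exact ⟨l, by simp [hl]⟩

theorem IsCell.abs_sub_le (h : IsCell s) (i j : Fin (n + 2)) (l : Fin (n + 1)) :
    |s i l - s j l| ≤ 1 := by
  obtain ⟨b, p, hp, -⟩ := h.exists_order
  have hi := hp l (i - b)
  have hj := hp l (j - b)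
  rw [add_sub_cancel] at hi hj
  rw [hi, hj, abs_le]
  split_ifs <;> omega

theorem IsCell.injective (h : IsCell s) : Function.Injective s := by
  obtain ⟨b, p, hp, hp'⟩ := h.exists_order
  have key : ∀ t t' : Fin (n + 2), t < t' → s (b + t) ≠ s (b + t') := by
    intro t t' htt h
    obtain ⟨l, rfl⟩ := hp' t (htt.trans_le (Fin.le_last _)).ne
    have := congrFun h l
    rw [hp, hp] at this
    simp [htt] at this
  intro i j hij
  by_contra hne
  have hi : b + (i - b) = i := add_sub_cancel b i
  have hj : b + (j - b) = j := add_sub_cancel b j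
  rcases lt_trichotomy (i - b) (j - b) with h | h | h
  · exact key _ _ h (by rw [hi, hj, hij])
  · exact hne (sub_left_injective h)
  · exact key _ _ h (by rw [hi, hj, hij])

theorem IsCell.eq_zero_of_antipodal (h : IsCell s) {i j : Fin (n + 2)} (hij : s i = -s j) :
    s i = 0 := by
  ext l
  have h1 := h.abs_sub_le i j l
  have h2 := congrFun hij l
  rw [Pi.neg_apply] at h2
  rw [abs_le] at h1
  simp only [Pi.zero_apply]
  omega

theorem IsCell.pivot_ne (h : IsCell s) : cellPivot s 0 ≠ s 0 := by
  obtain ⟨σ, hσ⟩ := h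
  intro h
  rw [cellPivot_zero] at h
  have h0 := hσ 0
  have h1 := hσ (-1)
  rw [zero_add] at h0
  rw [neg_add_cancel] at h1
  have : latticeStep n (σ 0) = latticeStep n (σ (-1)) := by
    rw [← h0, ← h1]
    linear_combination (exp := 1) h
  exact fin_neg_one_ne_zero (σ.injective (latticeStep_injective this)).symm

theorem IsCellWith.unique {σ : Equiv.Perm (Fin (n + 2))} {t : Fin (n + 2) → Fin (n + 1) → ℤ}
    (hs : IsCellWith σ s) (ht : IsCellWith σ t) (h : s 0 = t 0) : s = t := by
  ext i : 1
  induction i using Fin.induction with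
  | zero => exact h
  | succ i ih =>
    have h1 := hs i.castSucc
    have h2 := ht i.castSucc
    rw [Fin.coeSucc_eq_succ] at h1 h2
    rw [eq_add_of_sub_eq h1, eq_add_of_sub_eq h2, ih]

theorem IsCellWith.apply_of_zero {σ : Equiv.Perm (Fin (n + 2))} (hs : IsCellWith σ s)
    (h : s 0 = 0) (i : Fin (n + 2)) (l : Fin (n + 1)) :
    s i l = (if σ.symm l.succ < i then 1 else 0) - if σ.symm 0 < i then 1 else 0 := by
  have key : ∀ (x : Fin (n + 2)) (j : Fin (n + 1)),
      (if x < j.succ then (1 : ℤ) else 0) = (if x < j.castSucc then 1 else 0) +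
        if j.castSucc = x then 1 else 0 := by
    intro x j
    rcases lt_trichotomy x j.castSucc with h | h | h
    · simp [h, h.ne', h.trans (Fin.castSucc_lt_succ (i := j))]
    · simp [h]
    · have : ¬ x < j.succ := by
        rw [not_lt]; exact Fin.castSucc_lt_iff_succ_le.1 h
      simp [this, h.not_gt, h.ne]
  induction i using Fin.induction with
  | zero => simp [h]
  | succ i ih =>
    have h1 := congrFun (hs i.castSucc) l
    rw [Fin.coeSucc_eq_succ, Pi.sub_apply, latticeStep_apply] at h1
    rw [eq_add_of_sub_eq h1, ih, key, key]
    simp only [← Equiv.eq_symm_apply]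
    ring

/-- The cell at the origin whose edge directions come in their standard order. -/
theorem exists_isCellWith_refl (n : ℕ) :
    ∃ s : Fin (n + 2) → Fin (n + 1) → ℤ, IsCellWith (Equiv.refl _) s ∧ s 0 = 0 := by
  refine ⟨fun i l => (if l.succ < i then 1 else 0) - if 0 < i then 1 else 0, fun i => ?_, ?_⟩
  · ext l
    rw [Pi.sub_apply, latticeStep_apply, Equiv.refl_apply]
    refine Fin.lastCases ?_ (fun j => ?_) i
    · rw [Fin.last_add_one]
      have h1 : l.succ < Fin.last (n + 1) ∨ l.succ = Fin.last (n + 1) := (Fin.le_last _).lt_or_eq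
      have h2 : (0 : Fin (n + 2)) < Fin.last (n + 1) := Fin.last_pos
      rcases h1 with h1 | h1
      · simp [h1, h1.ne', h2, h2.ne']
      · simp [h1, h2, h2.ne']
    · rw [Fin.coeSucc_eq_succ]
      have h1 : (0 : Fin (n + 2)) < j.succ := Fin.succ_pos j
      have h2 : ((0 : Fin (n + 2)) < j.castSucc) ↔ ¬ j.castSucc = 0 := Fin.pos_iff_ne_zero
      rcases lt_trichotomy l.succ j.castSucc with h | h | h
      · have h3 := h.trans (Fin.castSucc_lt_succ (i := j))
        simp only [h, h.ne', h1, h2, h3, if_true, if_false]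
        split_ifs <;> simp_all
      · simp only [← h, h1, if_true, lt_irrefl, Fin.succ_ne_zero, Fin.succ_pos, if_false]
        rw [if_pos (h ▸ Fin.castSucc_lt_succ)]
        simp
      · have h3 : ¬ l.succ < j.succ := by rw [not_lt]; exact Fin.castSucc_lt_iff_succ_le.1 h
        simp only [h.not_gt, h.ne, h1, h2, h3, if_true, if_false]
        split_ifs <;> simp_all
  · ext l; simp

end Cells

/-- The convex hull of the facet opposite to the vertex `v k` contains the origin. -/
def IsGoodFacet {n : ℕ} (v : Fin (n + 2) → Fin n → ℝ) (k : Fin (n + 2)) : Prop :=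
  ∃ c : Fin (n + 2) → ℝ, (∀ i, 0 ≤ c i) ∧ c k = 0 ∧ c ≠ 0 ∧ ∑ i, c i • v i = 0

/-- The points `v` stay linearly independent after two of them are removed. -/
def IsFacetGeneric {n : ℕ} (v : Fin (n + 2) → Fin n → ℝ) : Prop :=
  ∀ i j, i ≠ j → ∀ c : Fin (n + 2) → ℝ, c i = 0 → c j = 0 → ∑ i, c i • v i = 0 → c = 0

section GoodFacets

variable {n : ℕ} {v : Fin (n + 2) → Fin n → ℝ}

theorem IsFacetGeneric.exists_relation (hv : IsFacetGeneric v) (i₀ : Fin (n + 2)) :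
    ∃ q : Fin (n + 2) → ℝ, q i₀ = 1 ∧ ∑ i, q i • v i = 0 := by
  obtain ⟨j₀, hj₀⟩ := exists_ne i₀
  let T : (Fin (n + 2) → ℝ) →ₗ[ℝ] (Fin n → ℝ) × ℝ :=
    (Fintype.linearCombination ℝ v).prod (LinearMap.proj j₀)
  have hT : LinearMap.ker T ≠ ⊥ := by
    apply LinearMap.ker_ne_bot_of_finrank_lt
    simp
  obtain ⟨q, hq, hq0⟩ := Submodule.exists_mem_ne_zero_of_ne_bot hT
  rw [LinearMap.mem_ker] at hq
  have h1 : ∑ i, q i • v i = 0 := by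
    have := congrArg Prod.fst hq
    simpa [T, Fintype.linearCombination_apply] using this
  have h2 : q j₀ = 0 := congrArg Prod.snd hq
  have h3 : q i₀ ≠ 0 := fun h => hq0 (hv i₀ j₀ hj₀.symm q h h2 h1)
  refine ⟨(q i₀)⁻¹ • q, by simp [h3], ?_⟩
  simp only [Pi.smul_apply, smul_eq_mul, mul_smul, ← Finset.smul_sum, h1, smul_zero]

/-- A generic simplex with one facet containing the origin has exactly one other such facet. -/
theorem IsGoodFacet.existsUnique (hv : IsFacetGeneric v) {i₀ : Fin (n + 2)}
    (h : IsGoodFacet v i₀) : ∃! k, k ≠ i₀ ∧ IsGoodFacet v k := by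
  obtain ⟨p, hp, hpi, hp0, hps⟩ := h
  have hpos : ∀ j, j ≠ i₀ → 0 < p j := fun j hj =>
    (hp j).lt_of_ne fun h => hp0 (hv i₀ j hj.symm p hpi h.symm hps)
  have hcomb : ∀ (a b : Fin (n + 2) → ℝ) (t : ℝ), ∑ i, a i • v i = 0 → ∑ i, b i • v i = 0 →
      ∑ i, (a - t • b) i • v i = 0 := by
    intro a b t ha hb
    simp only [Pi.sub_apply, Pi.smul_apply, smul_eq_mul, sub_smul, mul_smul,
      Finset.sum_sub_distrib, ← Finset.smul_sum, ha, hb, smul_zero, sub_zero]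
  obtain ⟨q, hq, hqs⟩ := hv.exists_relation i₀
  obtain ⟨k, hk, hmin⟩ := Finset.exists_min_image (Finset.univ.erase i₀) (fun j => q j / p j)
    (by
      obtain ⟨j₀, hj₀⟩ := exists_ne i₀
      exact ⟨j₀, by simp [hj₀]⟩)
  have hk : k ≠ i₀ := by simpa using hk
  have hgood : IsGoodFacet v k := by
    refine ⟨q - (q k / p k) • p, fun j => ?_, ?_, fun h0 => ?_, hcomb q p _ hqs hps⟩
    · simp only [Pi.sub_apply, Pi.smul_apply, smul_eq_mul]
      by_cases hj : j = i₀
      · rw [hj, hpi, hq]; norm_num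
      · have := hmin j (by simp [hj])
        rw [le_div_iff₀ (hpos j hj)] at this
        linarith
    · simp only [Pi.sub_apply, Pi.smul_apply, smul_eq_mul]
      field_simp [(hpos k hk).ne']
      ring
    · have := congrFun h0 i₀
      simp [hpi, hq] at this
  refine ⟨k, ⟨hk, hgood⟩, ?_⟩
  rintro k' ⟨hk', hgood'⟩
  by_contra hne
  have hnorm : ∀ j, j ≠ i₀ → IsGoodFacet v j → ∃ c : Fin (n + 2) → ℝ, (∀ i, 0 ≤ c i) ∧
      c j = 0 ∧ c i₀ = 1 ∧ ∑ i, c i • v i = 0 := by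
    rintro j hj ⟨c, hc, hcj, hc0, hcs⟩
    have h3 : c i₀ ≠ 0 := fun h => hc0 (hv j i₀ hj c hcj h hcs)
    refine ⟨(c i₀)⁻¹ • c, fun i => ?_, by simp [hcj], by simp [h3], ?_⟩
    · exact mul_nonneg (inv_nonneg.2 (hc _)) (hc _)
    · simp only [Pi.smul_apply, smul_eq_mul, mul_smul, ← Finset.smul_sum, hcs, smul_zero]
  obtain ⟨c, hc, hck, hci, hcs⟩ := hnorm k hk hgood
  obtain ⟨c', hc', hck', hci', hcs'⟩ := hnorm k' hk' hgood'
  have hd : c - (1 : ℝ) • c' - ((c k - c' k) / p k) • p = 0 := by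
    refine hv i₀ k hk.symm _ ?_ ?_ (hcomb _ _ _ (hcomb _ _ _ hcs hcs') hps)
    · simp [hci, hci', hpi]
    · simp only [Pi.sub_apply, Pi.smul_apply, smul_eq_mul]
      field_simp [(hpos k hk).ne']
      ring
  have h1 := congrFun hd k'
  simp only [Pi.sub_apply, Pi.smul_apply, smul_eq_mul, Pi.zero_apply, hck', hck, one_mul, sub_zero,
    zero_sub] at h1
  have h2 : 0 ≤ c' k / p k * p k' := by have := hc' k; have := hp k; have := hp k'; positivity
  have h3 : c k' = 0 := by have := hc k'; rw [neg_div] at h1; linarith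
  have := hv k' k hne c h3 hck hcs
  simp [this] at hci

theorem IsGoodFacet.reindex {k : Fin (n + 2)} (e : Equiv.Perm (Fin (n + 2)))
    (h : IsGoodFacet v k) : IsGoodFacet (fun i => v (e i)) (e.symm k) := by
  obtain ⟨c, hc, hck, hc0, hcs⟩ := h
  refine ⟨fun i => c (e i), fun i => hc _, by simpa, fun h0 => hc0 ?_, ?_⟩
  · ext i
    simpa using congrFun h0 (e.symm i)
  · rw [← hcs]
    exact Equiv.sum_comp e (fun i => c i • v i)

theorem IsGoodFacet.neg {k : Fin (n + 2)} (h : IsGoodFacet v k) :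
    IsGoodFacet (fun i => -v i) k := by
  obtain ⟨c, hc, hck, hc0, hcs⟩ := h
  exact ⟨c, hc, hck, hc0, by simp [hcs]⟩

theorem IsGoodFacet.congr {k : Fin (n + 2)} {w : Fin (n + 2) → Fin n → ℝ} (h : IsGoodFacet v k)
    (hw : ∀ i, i ≠ k → w i = v i) : IsGoodFacet w k := by
  obtain ⟨c, hc, hck, hc0, hcs⟩ := h
  refine ⟨c, hc, hck, hc0, ?_⟩
  rw [← hcs]
  refine Finset.sum_congr rfl fun i _ => ?_
  by_cases hi : i = k
  · simp [hi, hck]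
  · rw [hw i hi]

end GoodFacets

/-- Cells avoiding the origin and contained in the region `In`, whose facet opposite to the
distinguished vertex is mapped by `G` around the origin. -/
def IsDoor {n : ℕ} (G : (Fin (n + 1) → ℤ) → Fin n → ℝ) (In : (Fin (n + 1) → ℤ) → Prop)
    (s : Fin (n + 2) → Fin (n + 1) → ℤ) : Prop :=
  IsCell s ∧ (∀ i, s i ≠ 0 ∧ In (s i)) ∧ IsGoodFacet (fun i => G (s i)) 0

section Doors

variable {n : ℕ} {G : (Fin (n + 1) → ℤ) → Fin n → ℝ} {In : (Fin (n + 1) → ℤ) → Prop}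
  {s : Fin (n + 2) → Fin (n + 1) → ℤ}

theorem IsDoor.neg (hG : ∀ v, G (-v) = -G v) (hIn : ∀ v, In v → In (-v)) (h : IsDoor G In s) :
    IsDoor G In (cellNeg s) := by
  refine ⟨h.1.neg, fun i => ⟨neg_ne_zero.2 (h.2.1 _).1, hIn _ (h.2.1 _).2⟩, ?_⟩
  have := (h.2.2.reindex (Equiv.neg _)).neg
  simpa [cellNeg, hG] using this

theorem IsDoor.rotate {k : Fin (n + 2)} (h : IsDoor G In s)
    (hk : IsGoodFacet (fun i => G (s i)) k) : IsDoor G In (cellRotate k s) := by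
  refine ⟨h.1.rotate k, fun i => h.2.1 _, ?_⟩
  have := hk.reindex (Equiv.addRight k)
  simpa [cellRotate] using this

theorem IsDoor.pivot (h : IsDoor G In s) (h0 : cellPivot s 0 ≠ 0) (hIn : In (cellPivot s 0)) :
    IsDoor G In (cellPivot s) := by
  refine ⟨h.1.pivot, fun i => ?_, ?_⟩
  · by_cases hi : i = 0
    · rw [hi]; exact ⟨h0, hIn⟩
    · rw [cellPivot_of_ne hi]; exact h.2.1 i
  · exact h.2.2.congr fun i hi => by rw [cellPivot_of_ne hi]

theorem cellNeg_ne (hs : s 0 ≠ 0) : cellNeg s ≠ s := by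
  intro h
  apply hs
  have h1 := congrFun h 0
  simp only [cellNeg, neg_zero] at h1
  exact neg_eq_self.1 h1

theorem four_dvd_card_doors (hG : ∀ v, G (-v) = -G v) (hIn : ∀ v, In v → In (-v))
    (hgen : ∀ s, IsCell s → (∀ i, s i ≠ 0 ∧ In (s i)) → IsFacetGeneric fun i => G (s i))
    (E : Finset (Fin (n + 2) → Fin (n + 1) → ℤ)) (hE : ∀ s, s ∈ E ↔ IsDoor G In s) :
    4 ∣ E.card := by
  classical
  have hex : ∀ s, IsDoor G In s → ∃! k, k ≠ 0 ∧ IsGoodFacet (fun i => G (s i)) k :=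
    fun s h => h.2.2.existsUnique (hgen s h.1 h.2.1)
  let k : (Fin (n + 2) → Fin (n + 1) → ℤ) → Fin (n + 2) := fun s =>
    if h : IsDoor G In s then (hex s h).choose else 0
  have hk0 : ∀ s, IsDoor G In s → k s ≠ 0 := fun s h => by
    simp only [k, dif_pos h]; exact (hex s h).choose_spec.1.1
  have hkg : ∀ s, IsDoor G In s → IsGoodFacet (fun i => G (s i)) (k s) := fun s h => by
    simp only [k, dif_pos h]; exact (hex s h).choose_spec.1.2
  have hku : ∀ s, IsDoor G In s → ∀ j, j ≠ 0 → IsGoodFacet (fun i => G (s i)) j → k s = j :=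
    fun s h j h1 h2 => by
      simp only [k, dif_pos h]; exact ((hex s h).choose_spec.2 j ⟨h1, h2⟩).symm
  have hA : ∀ s, IsDoor G In s → IsDoor G In (cellRotate (k s) s) := fun s h =>
    h.rotate (hkg s h)
  have hkA : ∀ s, IsDoor G In s → k (cellRotate (k s) s) = -k s := fun s h => by
    refine hku _ (hA s h) _ (neg_ne_zero.2 (hk0 s h)) ?_
    have := h.2.2.reindex (Equiv.addRight (k s))
    simpa [cellRotate] using this
  have hkN : ∀ s, IsDoor G In s → k (cellNeg s) = -k s := fun s h => by
    refine hku _ (h.neg hG hIn) _ (neg_ne_zero.2 (hk0 s h)) ?_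
    have := ((hkg s h).reindex (Equiv.neg _)).neg
    simpa [cellNeg, hG] using this
  refine four_dvd_card_of_commuting_involutions (fun s => cellRotate (k s) s) cellNeg E
    ?_ ?_ ?_ ?_ ?_ ?_ ?_ ?_ <;> intro s hs <;> rw [hE] at hs
  · rw [hE]; exact hA s hs
  · rw [hE]; exact hs.neg hG hIn
  · simp only [hkA s hs]
    ext i : 1
    simp [cellRotate]
  · exact cellNeg_cellNeg
  · simp only [hkN s hs]
    ext i : 1
    simp only [cellRotate, cellNeg]
    congr 2
    abel
  · intro h
    have := hs.1.injective (congrFun h 0)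
    rw [zero_add] at this
    exact hk0 s hs this
  · exact cellNeg_ne (hs.2.1 0).1
  · intro h
    have h1 := congrFun h 0
    simp only [cellRotate, cellNeg] at h1
    exact (hs.2.1 0).1 (hs.1.eq_zero_of_antipodal h1.symm)

theorem four_dvd_card_inner_doors (hG : ∀ v, G (-v) = -G v) (hIn : ∀ v, In v → In (-v))
    (E : Finset (Fin (n + 2) → Fin (n + 1) → ℤ))
    (hE : ∀ s, s ∈ E ↔ IsDoor G In s ∧ IsDoor G In (cellPivot s)) :
    4 ∣ E.card := by
  classical
  refine four_dvd_card_of_commuting_involutions cellPivot cellNeg E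
    ?_ ?_ ?_ ?_ ?_ ?_ ?_ ?_ <;> intro s hs <;> rw [hE] at hs
  · rw [hE, cellPivot_cellPivot]; exact hs.symm
  · rw [hE, cellPivot_cellNeg]; exact ⟨hs.1.neg hG hIn, hs.2.neg hG hIn⟩
  · exact cellPivot_cellPivot
  · exact cellNeg_cellNeg
  · exact cellPivot_cellNeg
  · intro h
    exact hs.1.1.pivot_ne (congrFun h 0)
  · exact cellNeg_ne (hs.1.2.1 0).1
  · intro h
    have h1 := congrFun h 1
    rw [cellPivot_of_ne one_ne_zero] at h1
    exact (hs.1.2.1 1).1 (hs.1.1.eq_zero_of_antipodal h1.symm)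

/-- There is no generic odd labelling for which the doors leading to the origin form a single
antipodal pair and no door leads out of the region. -/
theorem false_of_unique_door (hG : ∀ v, G (-v) = -G v) (hIn : ∀ v, In v → In (-v))
    (hfin : {v | In v}.Finite)
    (hgen : ∀ s, IsCell s → (∀ i, s i ≠ 0 ∧ In (s i)) → IsFacetGeneric fun i => G (s i))
    (hexit : ∀ s, IsDoor G In s → cellPivot s 0 ≠ 0 → In (cellPivot s 0))
    {z : Fin (n + 2) → Fin (n + 1) → ℤ} (hz0 : z 0 = 0) (hz : IsDoor G In (cellPivot z))
    (hinner : ∀ s, IsDoor G In s → cellPivot s 0 = 0 →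
      cellPivot s = z ∨ cellPivot s = cellNeg z) : False := by
  classical
  have hEfin : {s | IsDoor G In s}.Finite := by
    refine (Set.Finite.pi' (fun _ : Fin (n + 2) => hfin)).subset fun s hs i => (hs.2.1 i).2
  set E := hEfin.toFinset with hE
  have hmem : ∀ s, s ∈ E ↔ IsDoor G In s := fun s => by simp [hE]
  have h1 := four_dvd_card_doors hG hIn hgen E hmem
  have h2 := four_dvd_card_inner_doors hG hIn (E.filter fun s => IsDoor G In (cellPivot s))
    (fun s => by rw [Finset.mem_filter, hmem])
  have h3 : (E.filter fun s => ¬ IsDoor G In (cellPivot s)) =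
      {cellPivot z, cellNeg (cellPivot z)} := by
    ext s
    rw [Finset.mem_filter, hmem, Finset.mem_insert, Finset.mem_singleton]
    constructor
    · rintro ⟨hs, hs'⟩
      have h0 : cellPivot s 0 = 0 := by
        by_contra h0
        exact hs' (hs.pivot h0 (hexit s hs h0))
      rcases hinner s hs h0 with h | h
      · left; rw [← h, cellPivot_cellPivot]
      · right; rw [← cellPivot_cellNeg, ← h, cellPivot_cellPivot]
    · rintro (rfl | rfl)
      · refine ⟨hz, fun h => ?_⟩
        rw [cellPivot_cellPivot] at h
        exact (h.2.1 0).1 hz0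
      · refine ⟨hz.neg hG hIn, fun h => ?_⟩
        rw [cellPivot_cellNeg, cellPivot_cellPivot] at h
        exact (h.2.1 0).1 (by simp [cellNeg, hz0])
  have h4 := Finset.card_filter_add_card_filter_not (s := E)
    (fun s => IsDoor G In (cellPivot s))
  rw [h3, Finset.card_pair (cellNeg_ne (hz.2.1 0).1).symm] at h4
  omega

end Doors

theorem exists_mem_ball_notMem_submodules {E ι : Type*} [NormedAddCommGroup E] [NormedSpace ℝ E]
    [FiniteDimensional ℝ E] (I : Finset ι) (p : ι → Submodule ℝ E) (hp : ∀ i ∈ I, p i ≠ ⊤) (x : E)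
    {ε : ℝ} (hε : 0 < ε) : ∃ w, ‖w - x‖ < ε ∧ ∀ i ∈ I, w ∉ p i := by
  have : CompleteSpace E := FiniteDimensional.complete ℝ E
  have h1 : Dense (⋂ i ∈ (I : Set ι), ((p i : Set E))ᶜ) := by
    refine dense_biInter_of_isOpen (fun i _ => ?_) I.countable_toSet (fun i hi => ?_)
    · exact (Submodule.closed_of_finiteDimensional _).isOpen_compl
    · rw [← interior_eq_empty_iff_dense_compl, ← Set.not_nonempty_iff_eq_empty]
      exact fun h => hp i hi (Submodule.eq_top_of_nonempty_interior' _ h)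
  obtain ⟨w, hw, hw'⟩ := h1.exists_dist_lt x hε
  refine ⟨w, by rwa [← dist_eq_norm, dist_comm], fun i hi => ?_⟩
  have := Set.mem_iInter₂.1 hw i hi
  simpa using this

/-- A finite family of vectors of `ℝⁿ` can be perturbed into general position, without moving a
subfamily which is already in general position. -/
theorem exists_generic_perturbation {α : Type*} {n : ℕ} (g : α → Fin n → ℝ) (A₀ : Finset α)
    (hA₀ : ∀ c ⊆ A₀, c.card ≤ n → LinearIndepOn ℝ g (c : Set α)) {ε : ℝ} (hε : 0 < ε)
    (A : Finset α) :
    ∃ g' : α → Fin n → ℝ, (∀ a ∈ A₀, g' a = g a) ∧ (∀ a, ‖g' a - g a‖ < ε) ∧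
      ∀ c : Finset α, (∀ a ∈ c, a ∈ A₀ ∨ a ∈ A) → c.card ≤ n →
        LinearIndepOn ℝ g' (c : Set α) := by
  classical
  induction A using Finset.induction with
  | empty =>
    exact ⟨g, fun _ _ => rfl, fun _ => by simpa using hε, fun c hc =>
      hA₀ c fun a ha => by simpa using hc a ha⟩
  | insert a B ha ih =>
    obtain ⟨g', hg0, hgε, hg⟩ := ih
    by_cases haA : a ∈ A₀
    · refine ⟨g', hg0, hgε, fun c hc => hg c fun x hx => ?_⟩
      rcases hc x hx with h | h
      · exact Or.inl h
      · rcases Finset.mem_insert.1 h with rfl | h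
        · exact Or.inl haA
        · exact Or.inr h
    obtain ⟨w, hw, hw'⟩ := exists_mem_ball_notMem_submodules
      ((A₀ ∪ B).powerset.filter fun D => D.card < n)
      (fun D => Submodule.span ℝ (g' '' (D : Set α))) (fun D hD htop => by
        rw [Finset.mem_filter] at hD
        have h1 := finrank_span_finset_le_card (R := ℝ) (D.image g')
        rw [Finset.coe_image, Set.finrank, htop, finrank_top, Module.finrank_fin_fun] at h1
        have := Finset.card_image_le (s := D) (f := g')
        omega) (g a) hε
    refine ⟨Function.update g' a w, fun x hx => ?_, fun x => ?_, fun c hc hcn => ?_⟩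
    · rw [Function.update_of_ne (fun h : x = a => haA (h ▸ hx)), hg0 x hx]
    · by_cases hx : x = a
      · subst hx; simpa using hw
      · rw [Function.update_of_ne hx]; exact hgε x
    · have hcB : ∀ x ∈ c, x ≠ a → x ∈ A₀ ∨ x ∈ B := fun x hx hxa => by
        rcases hc x hx with h | h
        · exact Or.inl h
        · exact Or.inr ((Finset.mem_insert.1 h).resolve_left hxa)
      by_cases hac : a ∈ c
      · have hlt := Finset.card_erase_lt_of_mem hac
        have h1 : LinearIndepOn ℝ (Function.update g' a w) ((c.erase a : Finset α) : Set α) := by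
          refine (hg (c.erase a) (fun x hx => ?_) (by omega)).congr fun x hx => ?_
          · exact hcB x (Finset.mem_of_mem_erase hx) (Finset.ne_of_mem_erase hx)
          · rw [Function.update_of_ne (Finset.ne_of_mem_erase (Finset.mem_coe.1 hx))]
        have h2 : Function.update g' a w a ∉
            Submodule.span ℝ (Function.update g' a w '' ((c.erase a : Finset α) : Set α)) := by
          rw [Set.image_congr (g := g') fun x hx => Function.update_of_ne
            (Finset.ne_of_mem_erase (Finset.mem_coe.1 hx)) _ _, Function.update_self]
          refine hw' _ ?_
          rw [Finset.mem_filter, Finset.mem_powerset]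
          refine ⟨fun x hx => ?_, by omega⟩
          rw [Finset.mem_union]
          exact hcB x (Finset.mem_of_mem_erase hx) (Finset.ne_of_mem_erase hx)
        have h3 := h1.insert h2
        rwa [← Finset.coe_insert, Finset.insert_erase hac] at h3
      · have hne : ∀ x ∈ c, x ≠ a := fun x hx h => hac (h ▸ hx)
        refine (hg c (fun x hx => hcB x hx (hne x hx)) hcn).congr fun x hx => ?_
        rw [Function.update_of_ne (hne x (Finset.mem_coe.1 hx))]

theorem exists_generic_odd_perturbation {m n : ℕ} (G₀ : (Fin m → ℤ) → Fin n → ℝ)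
    (hG₀ : ∀ v, G₀ (-v) = -G₀ v) (A₀ A : Finset (Fin m → ℤ)) (hpos : ∀ v ∈ A₀, 0 < v)
    (hA₀ : ∀ c ⊆ A₀, c.card ≤ n → LinearIndepOn ℝ G₀ (c : Set (Fin m → ℤ)))
    (hA : ∀ v ∈ A, -v ∈ A) {ε : ℝ} (hε : 0 < ε) :
    ∃ G : (Fin m → ℤ) → Fin n → ℝ, (∀ v, G (-v) = -G v) ∧ (∀ v, ‖G v - G₀ v‖ < ε) ∧
      (∀ v ∈ A₀, G v = G₀ v) ∧
      ∀ s : Fin (n + 2) → Fin m → ℤ, Function.Injective s → (∀ i j, s i ≠ -s j) →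
        (∀ i, s i ∈ A) → IsFacetGeneric fun i => G (s i) := by
  classical
  obtain ⟨g, hg0, hgε, hg⟩ := exists_generic_perturbation G₀ A₀ hA₀ hε A
  let pos : (Fin m → ℤ) → Prop := fun v => 0 < toLex v
  have hposneg : ∀ v, pos (-v) ↔ toLex v < 0 := fun v => by simp only [pos, toLex_neg, neg_pos]
  have hG00 : G₀ 0 = 0 := by
    have := hG₀ 0
    rw [neg_zero] at this
    exact self_eq_neg.1 this
  let G : (Fin m → ℤ) → Fin n → ℝ := fun v => if pos v then g v else if pos (-v) then -g (-v) else 0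
  have hGpos : ∀ v, pos v → G v = g v := fun v h => by simp only [G, if_pos h]
  have hGneg : ∀ v, pos (-v) → G v = -g (-v) := fun v h => by
    have h' : ¬ pos v := ((hposneg v).1 h).not_gt
    simp only [G, if_pos h, if_neg h']
  have hcases : ∀ v, pos v ∨ pos (-v) ∨ v = 0 := fun v => by
    rw [hposneg]
    rcases lt_trichotomy (toLex v) 0 with h | h | h
    · exact Or.inr (Or.inl h)
    · exact Or.inr (Or.inr h)
    · exact Or.inl h
  have hG0 : G 0 = 0 := by
    have h : ¬ pos 0 := fun h => (h : (0 : Lex (Fin m → ℤ)) < 0).ne rfl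
    simp only [G, neg_zero, h, if_false]
  refine ⟨G, fun v => ?_, fun v => ?_, fun v hv => ?_, fun s hs hanti hsA => ?_⟩
  · rcases hcases v with h | h | rfl
    · rw [hGpos v h, hGneg (-v) (by rwa [neg_neg]), neg_neg]
    · rw [hGneg v h, hGpos (-v) h, neg_neg]
    · simp [hG0]
  · rcases hcases v with h | h | rfl
    · rw [hGpos v h]; exact hgε v
    · have h1 := hgε (-v)
      rwa [hG₀, sub_neg_eq_add, ← norm_neg, neg_add, ← sub_eq_add_neg, ← hGneg v h] at h1
    · simpa [hG0, hG00] using hε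
  · rw [hGpos v (Pi.toLex_strictMono (hpos v hv)), hg0 v hv]
  · intro i j hij c hci hcj hc
    let sg : Fin (n + 2) → ℝ := fun l => if pos (s l) then 1 else -1
    let rp : Fin (n + 2) → Fin m → ℤ := fun l => if pos (s l) then s l else -s l
    have hne : ∀ l, s l ≠ 0 := fun l h => hanti l l (by simp [h])
    have hGs : ∀ l, G (s l) = sg l • g (rp l) := fun l => by
      rcases hcases (s l) with h | h | h
      · simp [sg, rp, h, hGpos]
      · have h' : ¬ pos (s l) := ((hposneg _).1 h).not_gt
        simp [sg, rp, h', hGneg _ h]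
      · exact absurd h (hne l)
    have hrp : Function.Injective rp := fun a b hab => by
      simp only [rp] at hab
      split_ifs at hab
      · exact hs hab
      · exact absurd hab (hanti _ _)
      · exact absurd hab.symm (hanti _ _)
      · exact hs (neg_injective hab)
    let J : Finset (Fin (n + 2)) := (Finset.univ.erase i).erase j
    have hJ : J.card = n := by
      rw [Finset.card_erase_of_mem (by simp [hij.symm]), Finset.card_erase_of_mem (by simp)]
      simp
    have hind : LinearIndepOn ℝ g ((J.image rp : Finset _) : Set (Fin m → ℤ)) := by
      refine hg _ (fun a ha => Or.inr ?_) (Finset.card_image_le.trans hJ.le)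
      obtain ⟨l, -, rfl⟩ := Finset.mem_image.1 ha
      simp only [rp]
      split_ifs
      · exact hsA l
      · exact hA _ (hsA l)
    have hind' : LinearIndepOn ℝ (g ∘ rp) (J : Set (Fin (n + 2))) := by
      rw [Finset.coe_image] at hind
      exact hind.comp_of_image hrp.injOn
    rw [linearIndepOn_finset_iff] at hind'
    have h0 : ∀ l ∈ J, c l * sg l = 0 := by
      refine hind' (fun l => c l * sg l) ?_
      rw [← hc]
      symm
      have : ∀ l ∉ J, c l • G (s l) = 0 := fun l hl => by
        have : l = j ∨ l = i := by
          by_contra h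
          push Not at h
          exact hl (by simp [J, h.1, h.2])
        rcases this with rfl | rfl <;> simp [hci, hcj]
      rw [← Finset.sum_subset (Finset.subset_univ J) fun l _ hl => this l hl]
      refine Finset.sum_congr rfl fun l _ => ?_
      rw [hGs, smul_smul, Function.comp]
    ext l
    by_cases hl : l ∈ J
    · have h1 := h0 l hl
      have h2 : sg l ≠ 0 := by simp only [sg]; split_ifs <;> norm_num
      simpa [h2] using h1
    · have : l = j ∨ l = i := by
        by_contra h
        push Not at h
        exact hl (by simp [J, h.1, h.2])
      rcases this with rfl | rfl <;> simp [hci, hcj]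

/-- A linear map with kernel spanned by `(1, 2, …, n + 1)`. -/
def latticeProj {n : ℕ} (x : Fin (n + 1) → ℤ) (j : Fin n) : ℝ :=
  (x j.succ : ℝ) - ((j : ℕ) + 2) * x 0

section OriginCells

variable {n : ℕ} {s z : Fin (n + 2) → Fin (n + 1) → ℤ} {σ : Equiv.Perm (Fin (n + 2))}

theorem latticeProj_neg (x : Fin (n + 1) → ℤ) : latticeProj (-x) = -latticeProj x := by
  ext j
  simp [latticeProj]
  ring

/-- The sum of the coefficients with index above `u`. -/
def tailSum (c : Fin (n + 2) → ℝ) (u : Fin (n + 2)) : ℝ := ∑ i, if u < i then c i else 0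

theorem tailSum_last (c : Fin (n + 2) → ℝ) : tailSum c (Fin.last (n + 1)) = 0 := by
  refine Finset.sum_eq_zero fun i _ => ?_
  rw [if_neg (Fin.le_last i).not_gt]

theorem tailSum_castSucc (c : Fin (n + 2) → ℝ) (j : Fin (n + 1)) :
    tailSum c j.castSucc = tailSum c j.succ + c j.succ := by
  have h : c j.succ = ∑ i, if i = j.succ then c i else 0 := by simp
  rw [h, tailSum, tailSum, ← Finset.sum_add_distrib]
  refine Finset.sum_congr rfl fun i _ => ?_
  rcases lt_trichotomy j.succ i with h | h | h
  · simp [h, h.ne', (Fin.castSucc_lt_succ (i := j)).trans h]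
  · simp [← h]
  · have h' : ¬ j.castSucc < i := by
      rw [not_lt]; exact Fin.le_castSucc_iff.2 h
    simp [h.not_gt, h.ne, h']

theorem tailSum_antitone {c : Fin (n + 2) → ℝ} (hc : ∀ i, 0 ≤ c i) : Antitone (tailSum c) := by
  intro u v huv
  refine Finset.sum_le_sum fun i _ => ?_
  by_cases h : v < i
  · rw [if_pos h, if_pos (huv.trans_lt h)]
  · rw [if_neg h]; split_ifs
    · exact hc i
    · exact le_rfl

/-- A relation between the projected vertices makes the tail sums affine in the numbering of the
edge directions. -/
theorem IsCellWith.tailSum_eq (hs : IsCellWith σ s) (h0 : s 0 = 0) {c : Fin (n + 2) → ℝ}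
    (hc : ∑ i, c i • latticeProj (s i) = 0) :
    ∃ τ : ℝ, ∀ u, tailSum c u = τ * (σ u : ℕ) + tailSum c (σ.symm 0) := by
  have h1 : ∀ l : Fin (n + 1), ∑ i, c i * (s i l : ℝ) =
      tailSum c (σ.symm l.succ) - tailSum c (σ.symm 0) := by
    intro l
    rw [tailSum, tailSum, ← Finset.sum_sub_distrib]
    refine Finset.sum_congr rfl fun i _ => ?_
    rw [hs.apply_of_zero h0]
    push_cast
    split_ifs <;> simp
  refine ⟨∑ i, c i * (s i 0 : ℝ), fun u => ?_⟩
  obtain ⟨m, rfl⟩ := σ.symm.surjective u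
  rw [Equiv.apply_symm_apply]
  refine Fin.cases ?_ (fun l => ?_) m
  · simp
  refine Fin.cases ?_ (fun j => ?_) l
  · rw [h1]; simp
  · have h2 : (∑ i, c i • latticeProj (s i)) j = 0 := congrFun hc j
    have h3 : ∑ i, c i * (s i j.succ : ℝ) = ((j : ℕ) + 2) * ∑ i, c i * (s i 0 : ℝ) := by
      rw [← sub_eq_zero, ← h2, Finset.mul_sum, ← Finset.sum_sub_distrib, Finset.sum_apply]
      refine Finset.sum_congr rfl fun i _ => ?_
      simp [latticeProj]
      ring
    rw [h1 j.succ] at h3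
    rw [sub_eq_iff_eq_add.1 h3]
    push_cast [Fin.val_succ]
    ring

theorem eq_zero_of_tailSum_eq_zero {c : Fin (n + 2) → ℝ} (hc : c 0 = 0) (h : ∀ u, tailSum c u = 0) :
    c = 0 := by
  ext i
  refine Fin.cases hc (fun j => ?_) i
  have := tailSum_castSucc c j
  rw [h, h] at this
  simpa using this.symm

/-- The projected vertices of a cell at the origin are linearly independent as soon as one of them
is removed. -/
theorem IsCellWith.eq_zero_of_relation (hs : IsCellWith σ s) (h0 : s 0 = 0) {c : Fin (n + 2) → ℝ}
    (hc : ∑ i, c i • latticeProj (s i) = 0) (hc0 : c 0 = 0) {k : Fin (n + 2)} (hk : k ≠ 0)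
    (hck : c k = 0) : c = 0 := by
  obtain ⟨τ, hτ⟩ := hs.tailSum_eq h0 hc
  obtain ⟨j, rfl⟩ := Fin.exists_succ_eq.2 hk
  have h1 := tailSum_castSucc c j
  rw [hck, hτ, hτ j.succ, add_zero, add_left_inj] at h1
  have h2 : τ = 0 := by
    by_contra hne
    have h3 := mul_left_cancel₀ hne h1
    have h4 : j.castSucc = j.succ := σ.injective (Fin.ext (by exact_mod_cast h3))
    exact (Fin.castSucc_lt_succ (i := j)).ne h4
  refine eq_zero_of_tailSum_eq_zero hc0 fun u => ?_
  have h5 := hτ (Fin.last (n + 1))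
  rw [tailSum_last, h2, zero_mul, zero_add] at h5
  rw [hτ, ← h5, h2]
  simp

/-- Only two cells at the origin have a projected facet opposite to the origin whose convex hull
contains the origin. -/
theorem IsCellWith.eq_or_eq_of_isGoodFacet (hs : IsCellWith σ s) (h0 : s 0 = 0)
    (hz : IsCellWith (Equiv.refl _) z) (hz0 : z 0 = 0)
    (hg : IsGoodFacet (fun i => latticeProj (s i)) 0) : s = z ∨ s = cellNeg z := by
  obtain ⟨c, hc, hc0, hcne, hcs⟩ := hg
  obtain ⟨τ, hτ⟩ := hs.tailSum_eq h0 hcs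
  have hanti := tailSum_antitone hc
  rcases lt_trichotomy τ 0 with h | h | h
  · left
    have hmono : StrictMono σ := by
      intro u v huv
      refine lt_of_le_of_ne ?_ (σ.injective.ne huv.ne)
      have := hanti huv.le
      rw [hτ u, hτ v, add_le_add_iff_right, mul_le_mul_left_of_neg h] at this
      exact_mod_cast this
    have : σ = Equiv.refl _ := Equiv.coe_fn_injective
      ((hmono.range_inj strictMono_id).1 (by simp))
    subst this
    exact hs.unique hz (h0.trans hz0.symm)
  · exfalso
    refine hcne (eq_zero_of_tailSum_eq_zero hc0 fun u => ?_)
    have h5 := hτ (Fin.last (n + 1))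
    rw [tailSum_last, h, zero_mul, zero_add] at h5
    rw [hτ, ← h5, h]
    simp
  · right
    have hmono : StrictMono (σ.trans Fin.revPerm) := by
      intro u v huv
      simp only [Equiv.trans_apply, Fin.revPerm_apply, Fin.rev_lt_rev]
      refine lt_of_le_of_ne ?_ (σ.injective.ne huv.ne')
      have := hanti huv.le
      rw [hτ u, hτ v, add_le_add_iff_right, mul_le_mul_iff_right₀ h] at this
      exact_mod_cast this
    have h1 : σ.trans Fin.revPerm = Equiv.refl _ := Equiv.coe_fn_injective
      ((hmono.range_inj strictMono_id).1 (by simp))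
    have h2 : σ = Fin.revPerm.trans (Equiv.refl _) := by
      ext1 i
      have := Equiv.congr_fun h1 i
      simp only [Equiv.trans_apply, Fin.revPerm_apply, Equiv.refl_apply] at this ⊢
      rw [← Fin.rev_inj, Fin.rev_rev, this]
    subst h2
    exact hs.unique hz.neg (by simp [cellNeg, h0, hz0])

theorem isGoodFacet_latticeProj (hz : IsCellWith (Equiv.refl _) z) (hz0 : z 0 = 0) :
    IsGoodFacet (fun i => latticeProj (z i)) 0 := by
  let c : Fin (n + 2) → ℝ := fun i => if i = 0 then 0 else 1
  refine ⟨c, fun i => ?_, by simp [c], fun h => ?_, ?_⟩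
  · simp only [c]; split_ifs <;> norm_num
  · simpa [c] using congrFun h 1
  · have h1 : ∀ l : Fin (n + 1), ∑ i, (z i l : ℝ) = -((l : ℕ) + 1) := by
      intro l
      have h2 : ∀ u : Fin (n + 2), (∑ i, if u < i then (1 : ℝ) else 0) = n + 1 - (u : ℕ) := by
        intro u
        rw [Finset.sum_boole, Finset.filter_lt_eq_Ioi, Fin.card_Ioi]
        have := u.2
        rw [Nat.cast_sub (by omega)]
        push_cast
        ring
      simp only [hz.apply_of_zero hz0]
      push_cast
      rw [Finset.sum_sub_distrib, h2, h2]
      simp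
      ring
    have h3 : ∀ i, c i • latticeProj (z i) = latticeProj (z i) := by
      intro i
      by_cases hi : i = 0
      · subst hi
        ext j
        simp [latticeProj, hz0]
      · simp [c, hi]
    simp only [h3]
    ext j
    simp only [latticeProj, Finset.sum_apply, Finset.sum_sub_distrib, ← Finset.mul_sum, h1]
    push_cast [Fin.val_succ]
    simp
    ring

theorem exists_gap_of_isCell (hz : IsCellWith (Equiv.refl _) z) (hz0 : z 0 = 0) :
    ∃ δ : ℝ, 0 < δ ∧ ∀ t : Fin (n + 2) → Fin (n + 1) → ℤ, IsCell t → t 0 = 0 → t ≠ z →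
      t ≠ cellNeg z → ∀ c : Fin (n + 2) → ℝ, (∀ i, 0 ≤ c i) → c 0 = 0 → ∑ i, c i = 1 →
        δ ≤ ‖∑ i, c i • latticeProj (t i)‖ := by
  have key : ∀ σ : Equiv.Perm (Fin (n + 2)), ∃ δ : ℝ, 0 < δ ∧
      ∀ t : Fin (n + 2) → Fin (n + 1) → ℤ, IsCellWith σ t → t 0 = 0 → t ≠ z →
      t ≠ cellNeg z → ∀ c : Fin (n + 2) → ℝ, (∀ i, 0 ≤ c i) → c 0 = 0 → ∑ i, c i = 1 →
        δ ≤ ‖∑ i, c i • latticeProj (t i)‖ := by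
    intro σ
    by_cases hex : ∃ t : Fin (n + 2) → Fin (n + 1) → ℤ, IsCellWith σ t ∧ t 0 = 0 ∧ t ≠ z ∧
      t ≠ cellNeg z
    · obtain ⟨t, ht, ht0, htz, htz'⟩ := hex
      have hK : IsCompact (stdSimplex ℝ (Fin (n + 2)) ∩ {c | c 0 = 0}) :=
        (isCompact_stdSimplex ℝ _).inter_right
          (isClosed_eq (continuous_apply 0) continuous_const)
      obtain ⟨δ, hδ, hδ'⟩ := hK.exists_forall_le' (f := fun c => ‖∑ i, c i • latticeProj (t i)‖)
        (a := 0) (by fun_prop) (fun c hc => by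
          rw [norm_pos_iff]
          intro h
          refine (ht.eq_or_eq_of_isGoodFacet ht0 hz hz0 ⟨c, hc.1.1, hc.2, fun h0 => ?_, h⟩).elim
            htz htz'
          have := hc.1.2
          simp [h0] at this)
      refine ⟨δ, hδ, fun t' ht' ht0' _ _ c hc hc0 hc1 => ?_⟩
      rw [ht'.unique ht (ht0'.trans ht0.symm)]
      exact hδ' c ⟨⟨hc, hc1⟩, hc0⟩
    · exact ⟨1, one_pos, fun t h1 h2 h3 h4 => absurd ⟨t, h1, h2, h3, h4⟩ hex⟩
  choose δ hδ hδ' using key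
  obtain ⟨σ₀, -, hσ₀⟩ := Finset.exists_min_image Finset.univ δ ⟨Equiv.refl _, Finset.mem_univ _⟩
  refine ⟨δ σ₀, hδ σ₀, fun t ht h1 h2 h3 c hc hc0 hc1 => ?_⟩
  obtain ⟨σ, hσ⟩ := ht
  exact (hσ₀ σ (Finset.mem_univ _)).trans (hδ' σ t hσ h1 h2 h3 c hc hc0 hc1)

theorem IsGoodFacet.exists_sum_eq_one {v : Fin (n + 2) → Fin n → ℝ} {k : Fin (n + 2)}
    (h : IsGoodFacet v k) : ∃ c : Fin (n + 2) → ℝ, (∀ i, 0 ≤ c i) ∧ c k = 0 ∧ ∑ i, c i = 1 ∧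
      ∑ i, c i • v i = 0 := by
  obtain ⟨c, hc, hck, hc0, hcs⟩ := h
  have hpos : 0 < ∑ i, c i := by
    refine (Finset.sum_nonneg fun i _ => hc i).lt_of_ne fun h => hc0 ?_
    ext i
    exact (Finset.sum_eq_zero_iff_of_nonneg fun i _ => hc i).1 h.symm i (Finset.mem_univ i)
  refine ⟨(∑ i, c i)⁻¹ • c, fun i => mul_nonneg (inv_nonneg.2 hpos.le) (hc i), by simp [hck], ?_, ?_⟩
  · simp only [Pi.smul_apply, smul_eq_mul, ← Finset.mul_sum]
    exact inv_mul_cancel₀ hpos.ne'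
  · simp only [Pi.smul_apply, smul_eq_mul, mul_smul, ← Finset.smul_sum, hcs, smul_zero]

theorem norm_sum_smul_sub_le {ι E : Type*} [NormedAddCommGroup E] [NormedSpace ℝ E] (I : Finset ι)
    {c : ι → ℝ} (hc : ∀ i, 0 ≤ c i) (hc1 : ∑ i ∈ I, c i = 1) {v w : ι → E} {ε : ℝ}
    (h : ∀ i ∈ I, c i ≠ 0 → ‖v i - w i‖ ≤ ε) :
    ‖∑ i ∈ I, c i • v i - ∑ i ∈ I, c i • w i‖ ≤ ε := by
  rw [← Finset.sum_sub_distrib]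
  refine (norm_sum_le _ _).trans ?_
  calc _ ≤ ∑ i ∈ I, c i * ε := by
        refine Finset.sum_le_sum fun i hi => ?_
        rw [← smul_sub, norm_smul, Real.norm_of_nonneg (hc i)]
        by_cases h0 : c i = 0
        · simp [h0]
        · exact mul_le_mul_of_nonneg_left (h i hi h0) (hc i)
    _ = ε := by rw [← Finset.sum_mul, hc1, one_mul]

theorem exists_unique_good_cell (hz : IsCellWith (Equiv.refl _) z) (hz0 : z 0 = 0) :
    ∃ δ : ℝ, 0 < δ ∧ ∀ G : (Fin (n + 1) → ℤ) → Fin n → ℝ,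
      (∀ v : Fin (n + 1) → ℤ, (∀ l, |v l| ≤ 1) → ‖G v - latticeProj v‖ < δ) →
      ∀ t : Fin (n + 2) → Fin (n + 1) → ℤ, IsCell t → t 0 = 0 →
        IsGoodFacet (fun i => G (t i)) 0 → t = z ∨ t = cellNeg z := by
  obtain ⟨δ, hδ, hgap⟩ := exists_gap_of_isCell hz hz0
  refine ⟨δ / 2, by positivity, fun G hG t ht ht0 hg => ?_⟩
  by_contra hne
  push Not at hne
  obtain ⟨c, hc, hc0, hc1, hcs⟩ := hg.exists_sum_eq_one
  have h1 := hgap t ht ht0 hne.1 hne.2 c hc hc0 hc1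
  have h2 := norm_sum_smul_sub_le Finset.univ hc hc1 (v := fun i => G (t i))
    (w := fun i => latticeProj (t i)) (ε := δ / 2) (fun i _ _ => by
      refine (hG _ fun l => ?_).le
      have := ht.abs_sub_le i 0 l
      rwa [ht0, Pi.zero_apply, sub_zero] at this)
  rw [hcs, zero_sub, norm_neg] at h2
  linarith

end OriginCells

theorem linearIndepOn_of_cell {n : ℕ} {z : Fin (n + 2) → Fin (n + 1) → ℤ}
    {σ : Equiv.Perm (Fin (n + 2))} (hz : IsCellWith σ z) (hz0 : z 0 = 0)
    {c : Finset (Fin (n + 1) → ℤ)} (hc : c ⊆ (Finset.univ.erase 0).image fun i => -z i)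
    (hcn : c.card ≤ n) : LinearIndepOn ℝ latticeProj (c : Set (Fin (n + 1) → ℤ)) := by
  classical
  have hinj : Function.Injective fun i => -z i :=
    neg_injective.comp (IsCell.injective ⟨σ, hz⟩)
  set J := (Finset.univ.erase (0 : Fin (n + 2))).filter fun i => -z i ∈ c with hJ
  have hJc : J.image (fun i => -z i) = c := by
    ext v
    simp only [hJ, Finset.mem_image, Finset.mem_filter]
    constructor
    · rintro ⟨i, ⟨-, hi⟩, rfl⟩; exact hi
    · intro hv
      obtain ⟨i, hi, rfl⟩ := Finset.mem_image.1 (hc hv)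
      exact ⟨i, ⟨hi, hv⟩, rfl⟩
  obtain ⟨k, hk, hkJ⟩ : ∃ k ∈ Finset.univ.erase (0 : Fin (n + 2)), k ∉ J := by
    by_contra! h
    have h1 := Finset.card_le_card (show Finset.univ.erase (0 : Fin (n + 2)) ⊆ J from h)
    rw [Finset.card_erase_of_mem (Finset.mem_univ _), Finset.card_univ, Fintype.card_fin] at h1
    rw [← hJc, Finset.card_image_of_injective _ hinj] at hcn
    omega
  rw [linearIndepOn_finset_iff]
  intro f hf
  have h0 : (0 : Fin (n + 2)) ∉ J := by simp [hJ]
  have ha : (fun i => if i ∈ J then f (-z i) else 0) = 0 := by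
    refine hz.eq_zero_of_relation hz0 ?_ (by simp [h0]) (Finset.ne_of_mem_erase hk) (by simp [hkJ])
    rw [← hJc, Finset.sum_image hinj.injOn] at hf
    simp only [latticeProj_neg, smul_neg, Finset.sum_neg_distrib, neg_eq_zero] at hf
    rw [← hf]
    simp [ite_smul, Finset.sum_ite_mem]
  intro v hv
  rw [← hJc] at hv
  obtain ⟨i, hi, rfl⟩ := Finset.mem_image.1 hv
  simpa [hi] using congrFun ha i

/-- A combinatorial form of the Borsuk–Ulam theorem: an odd map from `ℝⁿ⁺¹` to `ℝⁿ` has a zero on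
the boundary of each bounded symmetric region containing the origin. -/
theorem exists_odd_zero_and_even_zero {n : ℕ} {G : (Fin (n + 1) → ℝ) → Fin n → ℝ}
    {F : (Fin (n + 1) → ℝ) → ℝ} (hGc : Continuous G) (hFc : Continuous F)
    (hG : ∀ x, G (-x) = -G x) (hF : ∀ x, F (-x) = F x) (hF0 : F 0 < 0)
    (hFR : ∃ R, ∀ x, R < ‖x‖ → 0 ≤ F x) : ∃ x, G x = 0 ∧ F x = 0 := by
  classical
  obtain ⟨R₀, hR₀⟩ := hFR
  set R := max R₀ 0 with hR
  have hFR : ∀ x, F x < 0 → ‖x‖ ≤ R := fun x hx => by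
    by_contra! h
    exact hx.not_ge (hR₀ x ((le_max_left _ _).trans_lt h))
  by_contra! hne
  have hK : IsCompact (closedBall (0 : Fin (n + 1) → ℝ) (R + 1)) := isCompact_closedBall _ _
  obtain ⟨ε, hε, hεK⟩ := hK.exists_forall_le' (f := fun x => max ‖G x‖ |F x|) (a := 0)
    (by fun_prop) (fun x _ => by
      rw [lt_max_iff, norm_pos_iff, abs_pos]
      by_cases h : G x = 0
      · exact Or.inr (hne x h)
      · exact Or.inl h)
  have hε4 : 0 < ε / 4 := by positivity
  obtain ⟨δ₁, hδ₁, hGu⟩ := Metric.uniformContinuousOn_iff.1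
    (hK.uniformContinuousOn_of_continuous hGc.continuousOn) _ hε4
  obtain ⟨δ₂, hδ₂, hFu⟩ := Metric.uniformContinuousOn_iff.1
    (hK.uniformContinuousOn_of_continuous hFc.continuousOn) _ hε4
  obtain ⟨δ₃, hδ₃, hF3⟩ := Metric.eventually_nhds_iff.1 (hFc.continuousAt.eventually_lt_const hF0)
  obtain ⟨N, hN⟩ := exists_nat_gt (2 / min (min δ₁ δ₂) (min δ₃ 1))
  have hmin : 0 < min (min δ₁ δ₂) (min δ₃ 1) := by positivity
  have hN0 : (0 : ℝ) < N := lt_trans (by positivity) hN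
  rw [div_lt_iff₀ hmin, ← div_lt_iff₀' hN0] at hN
  simp only [lt_min_iff] at hN
  obtain ⟨⟨hN1, hN2⟩, hN3, hN4⟩ := hN
  have h12 : 1 / (N : ℝ) ≤ 2 / N := by gcongr; norm_num
  let p : (Fin (n + 1) → ℤ) → Fin (n + 1) → ℝ := fun v l => (v l : ℝ) / N
  have hpneg : ∀ v, p (-v) = -p v := fun v => by ext l; simp [p, neg_div]
  have hpd : ∀ v w : Fin (n + 1) → ℤ, (∀ l, |v l - w l| ≤ 1) → dist (p v) (p w) ≤ 1 / N := by
    intro v w h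
    rw [dist_pi_le_iff (by positivity)]
    intro l
    rw [Real.dist_eq, ← sub_div, abs_div, abs_of_pos hN0]
    gcongr
    exact_mod_cast h l
  have hIn2 : ∀ v : Fin (n + 1) → ℤ, (∀ l, |v l| ≤ 2) → F (p v) < 0 := by
    intro v h
    refine hF3 (lt_of_le_of_lt ?_ hN3)
    rw [dist_pi_le_iff (by positivity)]
    intro l
    rw [Real.dist_eq, Pi.zero_apply, sub_zero, abs_div, abs_of_pos hN0]
    gcongr
    exact_mod_cast h l
  have hfin : {v : Fin (n + 1) → ℤ | F (p v) < 0}.Finite := by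
    refine (Set.Finite.pi' (fun _ : Fin (n + 1) => Set.finite_Icc (-⌈R * N⌉) ⌈R * N⌉)).subset ?_
    intro v hv l
    have h1 := (norm_le_pi_norm (p v) l).trans (hFR _ hv)
    rw [Real.norm_eq_abs, abs_div, abs_of_pos hN0, div_le_iff₀ hN0] at h1
    have h2 : ((|v l| : ℤ) : ℝ) ≤ ⌈R * N⌉ := by push_cast; exact h1.trans (Int.le_ceil _)
    exact abs_le.1 (by exact_mod_cast h2)
  let small : (Fin (n + 1) → ℤ) → Prop := fun v => ∀ l, |v l| ≤ 1
  let G₀ : (Fin (n + 1) → ℤ) → Fin n → ℝ := fun v => if small v then latticeProj v else G (p v)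
  have hG₀ : ∀ v, G₀ (-v) = -G₀ v := by
    intro v
    have h : small (-v) ↔ small v := by simp [small]
    simp only [G₀, h]
    split_ifs
    · exact latticeProj_neg v
    · rw [hpneg, hG]
  obtain ⟨z, hz, hz0⟩ := exists_isCellWith_refl n
  have hzc : IsCell z := ⟨_, hz⟩
  have hz1 : ∀ i, small (z i) := fun i l => by
    have := hzc.abs_sub_le i 0 l
    rwa [hz0, Pi.zero_apply, sub_zero] at this
  obtain ⟨δ, hδ, hunique⟩ := exists_unique_good_cell hz hz0
  set A₀ := (Finset.univ.erase (0 : Fin (n + 2))).image fun i => -z i with hA₀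
  have hA₀small : ∀ v ∈ A₀, G₀ v = latticeProj v := by
    intro v hv
    obtain ⟨i, -, rfl⟩ := Finset.mem_image.1 hv
    have : small (-z i) := by simpa [small] using hz1 i
    simp only [G₀, if_pos this]
  obtain ⟨G', hG'odd, hG'ε, hG'A, hgen⟩ := exists_generic_odd_perturbation G₀ hG₀ A₀ hfin.toFinset
    (fun v hv => by
      obtain ⟨i, hi, rfl⟩ := Finset.mem_image.1 hv
      refine lt_of_le_of_ne (fun l => ?_) fun h => ?_
      · rw [Pi.neg_apply, hz.apply_of_zero hz0, Equiv.refl_symm, Equiv.refl_apply,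
          Equiv.refl_apply]
        simp only [Fin.pos_iff_ne_zero.2 (Finset.ne_of_mem_erase hi), if_true, Pi.zero_apply]
        split_ifs <;> norm_num
      · exact Finset.ne_of_mem_erase hi
          (hzc.injective ((neg_eq_zero.1 h.symm).trans hz0.symm)))
    (fun c hc hcn => (linearIndepOn_of_cell hz hz0 hc hcn).congr fun v hv => (hA₀small v (hc hv)).symm)
    (fun v hv => by
      simp only [Set.Finite.mem_toFinset, Set.mem_ofPred_eq] at hv ⊢
      rwa [hpneg, hF]) (lt_min hδ hε4)
  refine false_of_unique_door (G := G') (In := fun v => F (p v) < 0) hG'odd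
    (fun v hv => by rwa [hpneg, hF]) hfin ?_ ?_ hz0 ?_ ?_
  · intro s hs hsI
    refine hgen s hs.injective (fun i j h => (hsI i).1 (hs.eq_zero_of_antipodal h)) fun i => ?_
    simpa using (hsI i).2
  · intro s hs hs0
    by_contra! hp
    have hd : ∀ i, i ≠ 0 → ∀ l, |s i l - cellPivot s 0 l| ≤ 1 := fun i hi l => by
      rw [← cellPivot_of_ne (s := s) hi]
      exact hs.1.pivot.abs_sub_le i 0 l
    have hbig : ∀ i, i ≠ 0 → ¬ small (s i) := fun i hi h => by
      refine hp.not_gt (hIn2 _ fun l => ?_)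
      have h1 := hd i hi l
      have h2 := h l
      rw [abs_le] at h1 h2 ⊢
      constructor <;> linarith
    have hin : ∀ i, p (s i) ∈ closedBall (0 : Fin (n + 1) → ℝ) (R + 1) := fun i => by
      rw [mem_closedBall_zero_iff]
      linarith [hFR _ (hs.2.1 i).2]
    have hpin : p (cellPivot s 0) ∈ closedBall (0 : Fin (n + 1) → ℝ) (R + 1) := by
      have h1 := hpd _ _ (hd 1 one_ne_zero)
      have h2 := hFR _ (hs.2.1 1).2
      have h3 := dist_triangle_left (p (cellPivot s 0)) 0 (p (s 1))
      rw [dist_zero_right (p (s 1))] at h3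
      rw [mem_closedBall]
      linarith
    have hlow : ε ≤ ‖G (p (s 1))‖ := by
      have h1 := hFu _ (hin 1) _ hpin ((hpd _ _ (hd 1 one_ne_zero)).trans_lt (by linarith))
      have h2 := (hs.2.1 1).2
      rw [Real.dist_eq, abs_lt] at h1
      have h3 : |F (p (s 1))| < ε := by rw [abs_lt]; constructor <;> linarith
      exact (le_max_iff.1 (hεK _ (hin 1))).resolve_right h3.not_ge
    obtain ⟨c, hc, hc0, hc1, hcs⟩ := hs.2.2.exists_sum_eq_one
    have h2 := norm_sum_smul_sub_le Finset.univ hc hc1 (v := fun i => G' (s i))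
      (w := fun _ => G (p (s 1))) (ε := ε / 4 + ε / 4) (fun i _ hi => by
        have hi0 : i ≠ 0 := fun h => hi (h ▸ hc0)
        have h3 := (hG'ε (s i)).trans_le (min_le_right _ _)
        simp only [G₀, if_neg (hbig i hi0)] at h3
        have h4 := hGu _ (hin i) _ (hin 1)
          ((hpd _ _ fun l => hs.1.abs_sub_le i 1 l).trans_lt (by linarith))
        rw [dist_eq_norm] at h4
        have h5 := norm_sub_le_norm_sub_add_norm_sub (G' (s i)) (G (p (s i))) (G (p (s 1)))
        linarith)
    rw [hcs, ← Finset.sum_smul, hc1, one_smul, zero_sub, norm_neg] at h2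
    linarith
  · refine ⟨hzc.pivot, fun i => ⟨?_, hIn2 _ fun l => ?_⟩, ?_⟩
    · by_cases hi : i = 0
      · rw [hi, ← hz0]; exact hzc.pivot_ne
      · rw [cellPivot_of_ne hi, ← hz0]; exact hzc.injective.ne hi
    · have h1 := hzc.pivot.abs_sub_le i 1 l
      rw [cellPivot_of_ne one_ne_zero] at h1
      have h2 := hz1 1 l
      rw [abs_le] at h1 h2 ⊢
      constructor <;> linarith
    · refine (isGoodFacet_latticeProj hz hz0).congr fun i hi => ?_
      have h1 : -z i ∈ A₀ := Finset.mem_image_of_mem _ (by simp [hi])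
      rw [cellPivot_of_ne hi, ← neg_neg (z i), hG'odd, hG'A _ h1, hA₀small _ h1,
        ← latticeProj_neg]
  · intro s hs hs0
    refine hunique G' (fun v hv => ?_) _ hs.1.pivot hs0
      (hs.2.2.congr fun i hi => by rw [cellPivot_of_ne hi])
    have h1 := (hG'ε v).trans_le (min_le_left _ _)
    have h2 : small v := hv
    simpa only [G₀, if_pos h2] using h1

/-- The closed ball of radius `ρ` in a subspace `V`, with the weak topology. -/
def WeakBall {X : Type*} [NormedAddCommGroup X] [InnerProductSpace ℝ X] (V : Submodule ℝ X)
    (ρ : ℝ) : Type _ := {x : X // x ∈ V ∧ ‖x‖ ≤ ρ}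

namespace WeakBall

variable {X : Type*} [NormedAddCommGroup X] [InnerProductSpace ℝ X] {V : Submodule ℝ X} {ρ : ℝ}

/-- The inclusion of the ball into the whole space; it is only weakly continuous. -/
def incl (x : WeakBall V ρ) : X := x.1

theorem incl_mem (x : WeakBall V ρ) : x.incl ∈ V := x.2.1

theorem norm_incl_le (x : WeakBall V ρ) : ‖x.incl‖ ≤ ρ := x.2.2

instance : TopologicalSpace (WeakBall V ρ) :=
  TopologicalSpace.induced (fun x (w : X) => ⟪x.incl, w⟫) inferInstance

instance : InvolutiveNeg (WeakBall V ρ) where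
  neg x := ⟨-x.1, V.neg_mem x.2.1, by rw [norm_neg]; exact x.2.2⟩
  neg_neg x := Subtype.ext (neg_neg x.1)

theorem incl_neg (x : WeakBall V ρ) : (-x).incl = -x.incl := rfl

theorem continuous_iff {A : Type*} [TopologicalSpace A] {g : A → WeakBall V ρ} :
    Continuous g ↔ ∀ w : X, Continuous fun a => ⟪(g a).incl, w⟫ := by
  rw [continuous_induced_rng, continuous_pi_iff]
  rfl

theorem continuous_inner (w : X) : Continuous fun x : WeakBall V ρ => ⟪x.incl, w⟫ :=
  continuous_iff.1 continuous_id w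

instance : ContinuousNeg (WeakBall V ρ) := ⟨continuous_iff.2 fun w => by
  simp only [incl_neg, inner_neg_left]
  exact (continuous_inner w).neg⟩

theorem ext_inner {x y : WeakBall V ρ} (h : ∀ w : X, ⟪x.incl, w⟫ = ⟪y.incl, w⟫) : x = y :=
  Subtype.ext (ext_inner_right ℝ h)

theorem compactSpace [CompleteSpace X] (hV : IsClosed (V : Set X)) :
    CompactSpace (WeakBall V ρ) := by
  let C : Set (WeakDual ℝ X) := (WeakDual.toStrongDual ⁻¹' closedBall (0 : StrongDual ℝ X) ρ) ∩
    ⋂ w : Vᗮ, {x | x (w : X) = 0}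
  have hC : IsCompact C := by
    refine (WeakDual.isCompact_closedBall (0 : StrongDual ℝ X) ρ).inter_right
      (isClosed_iInter fun w => ?_)
    exact isClosed_eq (WeakDual.eval_continuous _) continuous_const
  have := isCompact_iff_compactSpace.1 hC
  have : V.HasOrthogonalProjection := by
    have : CompleteSpace V := hV.completeSpace_coe
    infer_instance
  have hinner : ∀ (x : WeakDual ℝ X) (w : X),
      ⟪(InnerProductSpace.toDual ℝ X).symm (WeakDual.toStrongDual x), w⟫ = x w := fun x w => by
    rw [InnerProductSpace.toDual_symm_apply]; rfl
  let F : C → WeakBall V ρ := fun x =>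
    ⟨(InnerProductSpace.toDual ℝ X).symm (WeakDual.toStrongDual x.1), by
      rw [← Submodule.orthogonal_orthogonal V, Submodule.mem_orthogonal']
      intro w hw
      rw [hinner]
      exact Set.mem_iInter.1 x.2.2 ⟨w, hw⟩, by
      rw [LinearIsometryEquiv.norm_map]
      simpa using x.2.1⟩
  have hF : Continuous F := continuous_iff.2 fun w => by
    have : (fun a : C => ⟪(F a).incl, w⟫) = fun a : C => a.1 w := by
      ext a; exact hinner _ _
    rw [this]
    exact (WeakDual.eval_continuous w).comp continuous_subtype_val
  have hFs : Function.Surjective F := fun y => by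
    refine ⟨⟨WeakDual.toStrongDual.symm (InnerProductSpace.toDual ℝ X y.1), ?_, ?_⟩, ?_⟩
    · simpa using y.2.2
    · refine Set.mem_iInter.2 fun w => ?_
      exact Submodule.inner_right_of_mem_orthogonal y.2.1 w.2
    · refine Subtype.ext ?_
      simp [F]
  exact hFs.compactSpace hF

theorem metrizableSpace [CompactSpace (WeakBall V ρ)] [TopologicalSpace.SeparableSpace X] :
    TopologicalSpace.MetrizableSpace (WeakBall V ρ) := by
  let F : WeakBall V ρ → ℕ → ℝ := fun x n => ⟪x.incl, TopologicalSpace.denseSeq X n⟫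
  have hF : Continuous F := continuous_pi fun n => continuous_inner _
  have hFi : Function.Injective F := fun x y hxy => by
    refine ext_inner fun w => ?_
    refine congrFun ((TopologicalSpace.denseRange_denseSeq X).equalizer
      (continuous_const.inner continuous_id) (continuous_const.inner continuous_id) ?_) w
    ext n
    exact congrFun hxy n
  exact (hF.isClosedEmbedding hFi).isEmbedding.metrizableSpace

theorem weakConv {u : ℕ → WeakBall V ρ} {v : WeakBall V ρ} (h : Tendsto u atTop (𝓝 v)) :
    WeakConv (fun n => (u n).incl) v.incl := fun w =>
  ((continuous_inner w).tendsto v).comp h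

end WeakBall

namespace FountainSetup

variable {X : Type*} [NormedAddCommGroup X] [InnerProductSpace ℝ X] [CompleteSpace X]
variable (S : FountainSetup X)

theorem isClosed_Yk (k : ℕ) : IsClosed (S.Yk k : Set X) := by
  have : FiniteDimensional ℝ (Submodule.span ℝ (S.f '' {j | j ≤ k})) :=
    FiniteDimensional.span_of_finite ℝ ((Set.finite_le_nat k).image _)
  exact Submodule.isClosed_sup_finiteDimensional _ _ S.closedY

theorem inner_e_f (i j : ℕ) : ⟪S.e i, S.f j⟫ = 0 :=
  Submodule.inner_right_of_mem_orthogonal (S.e_mem i) (S.f_mem j)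

theorem orthonormal_sumElim : Orthonormal ℝ (Sum.elim S.e S.f) := by
  constructor
  · rintro (i | i)
    · exact S.orth_e.1 i
    · exact S.orth_f.1 i
  · rintro (i | i) (j | j) hij
    · exact S.orth_e.2 fun h => hij (by rw [h])
    · exact S.inner_e_f i j
    · simpa [real_inner_comm] using S.inner_e_f j i
    · exact S.orth_f.2 fun h => hij (by rw [h])

/-- The indices of the basis of `Y_k` in the order `f_k, f_0, …, f_{k-1}, e_0, e_1, …`. -/
def ykIndex (k i : ℕ) : ℕ ⊕ ℕ :=
  if i = 0 then Sum.inr k else if i ≤ k then Sum.inr (i - 1) else Sum.inl (i - k - 1)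

theorem ykIndex_injective (k : ℕ) : Function.Injective (ykIndex k) := by
  intro i j h
  simp only [ykIndex] at h
  split_ifs at h <;> simp only [Sum.inr.injEq, Sum.inl.injEq] at h <;> omega

/-- The basis of `Y_k` in the order `f_k, f_0, …, f_{k-1}, e_0, e_1, …`. -/
def ykBasis (k i : ℕ) : X := Sum.elim S.e S.f (ykIndex k i)

theorem orthonormal_ykBasis (k : ℕ) : Orthonormal ℝ (S.ykBasis k) :=
  S.orthonormal_sumElim.comp _ (ykIndex_injective k)

theorem ykBasis_mem (k i : ℕ) : S.ykBasis k i ∈ S.Yk k := by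
  simp only [ykBasis, ykIndex]
  have hf : ∀ j ≤ k, S.f j ∈ S.Yk k := fun j hj =>
    Submodule.mem_sup_right (Submodule.subset_span ⟨j, hj, rfl⟩)
  split_ifs
  · exact hf k le_rfl
  · exact hf _ (by omega)
  · exact Submodule.mem_sup_left (S.e_mem _)

theorem inner_eq_zero_of_mem_Y {w y : X} (hw : ∀ j, ⟪w, S.e j⟫ = 0) (hy : y ∈ S.Y) :
    ⟪w, y⟫ = 0 := by
  rw [← S.span_e] at hy
  have hle : (Submodule.span ℝ (Set.range S.e)).topologicalClosure ≤ (ℝ ∙ w)ᗮ := by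
    refine Submodule.topologicalClosure_minimal _ ?_ (Submodule.isClosed_orthogonal _)
    rw [Submodule.span_le]
    rintro _ ⟨j, rfl⟩
    exact Submodule.mem_orthogonal_singleton_iff_inner_right.2 (hw j)
  exact Submodule.mem_orthogonal_singleton_iff_inner_right.1 (hle hy)

theorem Zk_le (k : ℕ) {W : Submodule ℝ X} (hW : IsClosed (W : Set X))
    (h : ∀ j, k ≤ j → S.f j ∈ W) : S.Zk k ≤ W := by
  refine Submodule.topologicalClosure_minimal _ ?_ hW
  rw [Submodule.span_le]
  rintro _ ⟨j, hj, rfl⟩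
  exact h j hj

theorem mem_Zk_of_inner_eq_zero {k : ℕ} {z : X} (h : ∀ i, ⟪z, S.ykBasis k (i + 1)⟫ = 0) :
    z ∈ S.Zk k := by
  have hze : ∀ j, ⟪z, S.e j⟫ = 0 := fun j => by
    have := h (j + k)
    simpa [ykBasis, ykIndex, show ¬ j + k + 1 ≤ k by omega,
      show j + k + 1 - k - 1 = j by omega] using this
  have hzf : ∀ j < k, ⟪z, S.f j⟫ = 0 := fun j hj => by
    have := h j
    simpa [ykBasis, ykIndex, show j + 1 ≤ k by omega] using this
  have hclosed : IsClosed (S.Zk k : Set X) := Submodule.isClosed_topologicalClosure _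
  have hcomp : CompleteSpace (S.Zk k) := hclosed.completeSpace_coe
  obtain ⟨p, hp, q, hq, rfl⟩ := (S.Zk k).exists_add_mem_mem_orthogonal z
  have hpe : ∀ y ∈ S.Y, ⟪p, y⟫ = 0 := fun y hy => by
    have := S.Zk_le k (Submodule.isClosed_orthogonal S.Y) (fun j _ => S.f_mem j) hp
    exact Submodule.inner_left_of_mem_orthogonal hy this
  have hpf : ∀ j < k, ⟪p, S.f j⟫ = 0 := fun j hj => by
    have := S.Zk_le k (Submodule.isClosed_orthogonal (ℝ ∙ S.f j)) (fun i hi =>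
      Submodule.mem_orthogonal_singleton_iff_inner_right.2 (S.orth_f.2 (by omega))) hp
    exact Submodule.mem_orthogonal_singleton_iff_inner_left.1 this
  have hqf : ∀ j, ⟪q, S.f j⟫ = 0 := fun j => by
    by_cases hj : j < k
    · have := hzf j hj
      rwa [inner_add_left, hpf j hj, zero_add] at this
    · exact Submodule.inner_left_of_mem_orthogonal (Submodule.le_topologicalClosure _
        (Submodule.subset_span
          (Set.mem_image_of_mem S.f (show j ∈ {j | k ≤ j} from not_lt.1 hj)))) hq
  have hqY : q ∈ S.Yᗮ := by
    rw [Submodule.mem_orthogonal']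
    intro y hy
    have := S.inner_eq_zero_of_mem_Y hze hy
    rwa [inner_add_left, hpe y hy, zero_add] at this
  rw [← S.span_f] at hqY
  have hle : (Submodule.span ℝ (Set.range S.f)).topologicalClosure ≤ (ℝ ∙ q)ᗮ := by
    refine Submodule.topologicalClosure_minimal _ ?_ (Submodule.isClosed_orthogonal _)
    rw [Submodule.span_le]
    rintro _ ⟨j, rfl⟩
    exact Submodule.mem_orthogonal_singleton_iff_inner_right.2 (hqf j)
  have hq0 : q = 0 :=
    inner_self_eq_zero.1 (Submodule.mem_orthogonal_singleton_iff_inner_right.1 (hle hqY))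
  rwa [hq0, add_zero]

end FountainSetup

namespace WeakBall

variable {X : Type*} [NormedAddCommGroup X] [InnerProductSpace ℝ X] {V : Submodule ℝ X} {ρ : ℝ}

/-- The radial retraction of a subspace onto its ball. -/
def retract (hρ : 0 < ρ) (v : V) : WeakBall V ρ :=
  ⟨(ρ / max ρ ‖v‖) • (v : X), V.smul_mem _ v.2, by
    have h : 0 < max ρ ‖v‖ := lt_max_of_lt_left hρ
    rw [norm_smul, Real.norm_of_nonneg (by positivity), div_mul_eq_mul_div, div_le_iff₀ h]
    exact mul_le_mul_of_nonneg_left (le_max_right _ _) hρ.le⟩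

theorem incl_retract (hρ : 0 < ρ) (v : V) :
    (retract hρ v).incl = (ρ / max ρ ‖v‖) • (v : X) := rfl

theorem incl_retract_of_le (hρ : 0 < ρ) {v : V} (hv : ‖v‖ ≤ ρ) : (retract hρ v).incl = v := by
  rw [incl_retract, max_eq_left hv, div_self hρ.ne', one_smul]

theorem retract_neg (hρ : 0 < ρ) (v : V) : retract hρ (-v) = -retract hρ v :=
  Subtype.ext <| by
    change (ρ / max ρ ‖-v‖) • ((-v : V) : X) = -((ρ / max ρ ‖v‖) • (v : X))
    rw [norm_neg, Submodule.coe_neg, smul_neg]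

theorem continuous_incl_retract (hρ : 0 < ρ) :
    Continuous fun v : V => (retract hρ v).incl := by
  simp only [incl_retract]
  refine Continuous.smul (continuous_const.div (continuous_const.max continuous_norm) fun v => ?_)
    continuous_subtype_val
  exact (lt_max_of_lt_left hρ).ne'

theorem continuous_retract (hρ : 0 < ρ) : Continuous (retract (V := V) hρ) :=
  continuous_iff.2 fun _ => (continuous_incl_retract hρ).inner continuous_const

/-- A finite-dimensional approximation of an intersection point of an odd compact perturbation
of the ball with the orthogonal complement of `g 1, g 2, …`. -/
theorem exists_approx_zero {g : ℕ → X} (hg : Orthonormal ℝ g) (hgV : ∀ i, g i ∈ V) {r : ℝ}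
    (hr : 0 < r) (hρ : 0 < ρ) {h : WeakBall V ρ → X} (hc : Continuous h)
    (hodd : ∀ x, h (-x) = -h x) (n : ℕ) :
    ∃ u : WeakBall V ρ, (∀ j < n, ⟪u.incl + h u, g (j + 1)⟫ = 0) ∧
      u.incl - ⟪u.incl, g 0⟫ • g 0 ∈ Submodule.span ℝ (Set.range fun i => g (i + 1)) ∧
      ⟪u.incl + h u, u.incl - ⟪u.incl, g 0⟫ • g 0⟫ = 0 ∧
      max (‖u.incl + h u‖ - r) (‖u.incl‖ - ρ) = 0 := by
  let lin : (Fin (n + 1) → ℝ) → V := fun x => ∑ i, x i • (⟨g i, hgV i⟩ : V)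
  have hlin : ∀ x, (lin x : X) = ∑ i, x i • g i := fun x => by simp [lin]
  have hlinc : Continuous lin := by fun_prop
  have hlinneg : ∀ x, lin (-x) = -lin x := fun x => by
    simp only [lin, Pi.neg_apply, neg_smul, Finset.sum_neg_distrib]
  have hinner : ∀ x (i : Fin (n + 1)), ⟪(lin x : X), g i⟫ = x i := fun x i => by
    rw [hlin]
    exact (hg.comp (fun i : Fin (n + 1) => (i : ℕ)) Fin.val_injective).inner_left_fintype x i
  have hnorm : ∀ x, ‖x‖ ≤ ‖lin x‖ := fun x => by
    refine (pi_norm_le_iff_of_nonneg (norm_nonneg _)).2 fun i => ?_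
    rw [← hinner x i]
    refine (norm_inner_le_norm _ _).trans ?_
    rw [hg.1, mul_one, Submodule.coe_norm]
  let γ : (Fin (n + 1) → ℝ) → X := fun x =>
    (retract hρ (lin x)).incl + h (retract hρ (lin x))
  have hγc : Continuous γ := ((continuous_incl_retract hρ).comp hlinc).add
    (hc.comp ((continuous_retract hρ).comp hlinc))
  have hγodd : ∀ x, γ (-x) = -γ x := fun x => by
    simp only [γ, hlinneg, retract_neg, incl_neg, hodd, neg_add]
  have hγ0 : γ 0 = 0 := by
    have := hγodd 0
    rw [neg_zero] at this
    have h2 : (2 : ℝ) • γ 0 = 0 := by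
      rw [two_smul]
      nth_rewrite 1 [this]
      exact neg_add_cancel _
    exact (smul_eq_zero.1 h2).resolve_left two_ne_zero
  obtain ⟨x, hG, hF⟩ := exists_odd_zero_and_even_zero
    (G := fun x (j : Fin n) => ⟪γ x, g (j + 1)⟫)
    (F := fun x => max (‖γ x‖ - r) (‖lin x‖ - ρ))
    (continuous_pi fun j => hγc.inner continuous_const)
    ((hγc.norm.sub continuous_const).max (hlinc.norm.sub continuous_const))
    (fun x => by ext j; simp [hγodd]) (fun x => by simp [hγodd, hlinneg])
    (by simp [hγ0, lin, hr, hρ])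
    ⟨ρ, fun x hx => le_max_of_le_right (sub_nonneg.2 (hx.le.trans (hnorm x)))⟩
  have hle : ‖lin x‖ ≤ ρ := sub_nonpos.1 ((le_max_right _ _).trans hF.le)
  have hu := incl_retract_of_le hρ hle
  have h0 : (lin x : X) - ⟪(lin x : X), g 0⟫ • g 0 = ∑ j : Fin n, x j.succ • g (j + 1) := by
    have := hinner x 0
    rw [Fin.val_zero] at this
    rw [this, hlin, Fin.sum_univ_succ]
    simp
  refine ⟨retract hρ (lin x), fun j hj => congrFun hG ⟨j, hj⟩, ?_, ?_, ?_⟩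
  · rw [hu, h0]
    exact Submodule.sum_mem _ fun j _ =>
      Submodule.smul_mem _ _ (Submodule.subset_span ⟨(j : ℕ), rfl⟩)
  · rw [hu, h0, inner_sum]
    refine Finset.sum_eq_zero fun j _ => ?_
    rw [inner_smul_right, ← hu]
    exact mul_eq_zero_of_right _ (congrFun hG j)
  · rw [hu]
    have : γ x = lin x + h (retract hρ (lin x)) := by simp only [γ, hu]
    rw [← this]
    exact hF

end WeakBall

theorem FountainSetup.exists_mem_Zk_of_odd {X : Type*} [NormedAddCommGroup X]
    [InnerProductSpace ℝ X] [CompleteSpace X] (S : FountainSetup X) (k : ℕ) {r ρ : ℝ}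
    (hr : 0 < r) (hrρ : r < ρ) {h : WeakBall (S.Yk k) ρ → X} (hc : Continuous h)
    (hodd : ∀ x, h (-x) = -h x) :
    ∃ x, x.incl + h x ∈ S.Zk k ∧
      (‖x.incl + h x‖ = r ∨ ‖x.incl + h x‖ ≤ r ∧ ‖x.incl‖ = ρ) := by
  have := S.separable
  have := WeakBall.compactSpace (ρ := ρ) (S.isClosed_Yk k)
  have := WeakBall.metrizableSpace (V := S.Yk k) (ρ := ρ)
  set g := S.ykBasis k
  have hg : Orthonormal ℝ g := S.orthonormal_ykBasis k
  choose v hv1 hvs hv2 hv3 using fun n =>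
    WeakBall.exists_approx_zero hg (S.ykBasis_mem k) hr (hr.trans hrρ) hc hodd n
  obtain ⟨u, ψ, hψ, hu⟩ := CompactSpace.tendsto_subseq v
  have hy : Tendsto (fun n => h (v (ψ n))) atTop (𝓝 (h u)) := (hc.tendsto u).comp hu
  have hw : ∀ w, Tendsto (fun n => ⟪(v (ψ n)).incl, w⟫) atTop (𝓝 ⟪u.incl, w⟫) :=
    WeakBall.weakConv hu
  have hwγ : ∀ w, Tendsto (fun n => ⟪(v (ψ n)).incl + h (v (ψ n)), w⟫) atTop
      (𝓝 ⟪u.incl + h u, w⟫) := fun w => by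
    simp only [inner_add_left]
    exact (hw w).add (hy.inner tendsto_const_nhds)
  have hγ : ∀ i, ⟪u.incl + h u, g (i + 1)⟫ = 0 := fun i => by
    refine tendsto_nhds_unique_of_eventuallyEq (hwγ _) tendsto_const_nhds ?_
    filter_upwards [eventually_gt_atTop i] with n hn
    exact hv1 _ i (hn.trans_le hψ.le_apply)
  have hmem := S.mem_Zk_of_inner_eq_zero hγ
  have hzero : ⟪u.incl + h u, u.incl - ⟪u.incl, g 0⟫ • g 0⟫ = 0 := by
    have h1 : ∀ n, ⟪u.incl + h u, (v (ψ n)).incl - ⟪(v (ψ n)).incl, g 0⟫ • g 0⟫ = 0 := by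
      intro n
      have hle : Submodule.span ℝ (Set.range fun i => g (i + 1)) ≤ (ℝ ∙ (u.incl + h u))ᗮ := by
        rw [Submodule.span_le]
        rintro _ ⟨i, rfl⟩
        exact Submodule.mem_orthogonal_singleton_iff_inner_right.2 (hγ i)
      exact Submodule.mem_orthogonal_singleton_iff_inner_right.1 (hle (hvs _))
    have h2 : Tendsto (fun n => ⟪u.incl + h u, (v (ψ n)).incl - ⟪(v (ψ n)).incl, g 0⟫ • g 0⟫)
        atTop (𝓝 ⟪u.incl + h u, u.incl - ⟪u.incl, g 0⟫ • g 0⟫) := by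
      simp only [inner_sub_right, inner_smul_right]
      refine Tendsto.sub ?_ ((hw _).mul_const _)
      simpa only [real_inner_comm] using hw (u.incl + h u)
    exact tendsto_nhds_unique_of_eventuallyEq h2 tendsto_const_nhds (Eventually.of_forall h1)
  have key : ∀ x y : X, ⟪x + y, x - ⟪x, g 0⟫ • g 0⟫ = 0 →
      ‖x‖ ^ 2 = ⟪x, g 0⟫ ^ 2 - ⟪y, x⟫ + ⟪x, g 0⟫ * ⟪y, g 0⟫ := fun x y hxy => by
    rw [inner_add_left, inner_sub_right, inner_sub_right, inner_smul_right, inner_smul_right,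
      real_inner_self_eq_norm_sq] at hxy
    linarith
  have hsq : Tendsto (fun n => ‖(v (ψ n)).incl‖ ^ 2) atTop (𝓝 (‖u.incl‖ ^ 2)) := by
    rw [key _ _ hzero]
    simp only [fun n => key _ _ (hv2 n)]
    refine Tendsto.add (((hw _).pow 2).sub ?_) ((hw _).mul (hy.inner tendsto_const_nhds))
    have h0 : Tendsto (fun n => ⟪h (v (ψ n)) - h u, (v (ψ n)).incl⟫) atTop (𝓝 0) := by
      refine squeeze_zero_norm (fun n => (norm_inner_le_norm _ _).trans
        (mul_le_mul_of_nonneg_left (WeakBall.norm_incl_le _) (norm_nonneg _))) ?_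
      simpa using (hy.sub_const (h u)).norm.mul_const ρ
    have h1 := h0.add (hw (h u))
    simp only [zero_add] at h1
    rw [real_inner_comm]
    refine h1.congr fun n => ?_
    rw [inner_sub_left, real_inner_comm (h u)]
    ring
  have hstrong : Tendsto (fun n => (v (ψ n)).incl) atTop (𝓝 u.incl) := by
    rw [tendsto_iff_norm_sub_tendsto_zero]
    have h0 : Tendsto (fun n => ‖(v (ψ n)).incl - u.incl‖ ^ 2) atTop (𝓝 0) := by
      simp only [norm_sub_sq_real]
      have h1 := (hsq.sub ((hw u.incl).const_mul 2)).add_const (‖u.incl‖ ^ 2)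
      rw [real_inner_self_eq_norm_sq] at h1
      convert h1 using 2
      ring
    have := h0.sqrt
    simpa [Real.sqrt_sq] using this
  have hmax : max (‖u.incl + h u‖ - r) (‖u.incl‖ - ρ) = 0 :=
    tendsto_nhds_unique_of_eventuallyEq
      (((hstrong.add hy).norm.sub_const r).max (hstrong.norm.sub_const ρ)) tendsto_const_nhds
      (Eventually.of_forall fun n => hv3 _)
  refine ⟨u, hmem, ?_⟩
  have hle : ‖u.incl + h u‖ ≤ r := sub_nonpos.1 ((le_max_left _ _).trans hmax.le)
  rcases max_choice (‖u.incl + h u‖ - r) (‖u.incl‖ - ρ) with h1 | h1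
  · exact Or.inl (sub_eq_zero.1 (h1 ▸ hmax))
  · exact Or.inr ⟨hle, sub_eq_zero.1 (h1 ▸ hmax)⟩

section MeanValue

variable {X : Type*} [NormedAddCommGroup X] [InnerProductSpace ℝ X]

theorem exists_fderiv_eq_sub {φ : X → ℝ} {φ' : X → X →L[ℝ] ℝ}
    (hderiv : ∀ u, HasFDerivAt φ (φ' u) u) (x a : X) :
    ∃ t ∈ Ioo (0 : ℝ) 1, φ' (x + t • a) a = φ (x + a) - φ x := by
  have hd : ∀ t : ℝ, HasDerivAt (fun t : ℝ => φ (x + t • a)) (φ' (x + t • a) a) t := fun t => by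
    have h1 : HasDerivAt (fun t : ℝ => x + t • a) a t := by
      simpa using ((hasDerivAt_id t).smul_const a).const_add x
    exact (hderiv _).comp_hasDerivAt t h1
  obtain ⟨t, ht, h⟩ := exists_hasDerivAt_eq_slope (fun t : ℝ => φ (x + t • a)) _ zero_lt_one
    (fun t _ => (hd t).continuousAt.continuousWithinAt) (fun t _ => hd t)
  exact ⟨t, ht, by simpa using h⟩

theorem WeakConv.tendsto_sub_sub {φ : X → ℝ} {φ' : X → X →L[ℝ] ℝ}
    (hderiv : ∀ u, HasFDerivAt φ (φ' u) u) (hwsc : WeaklySeqContDeriv φ') {u : ℕ → X} {x : X}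
    (hu : WeakConv u x) (a : X) :
    Tendsto (fun n => (φ (u n + a) - φ (x + a)) - (φ (u n) - φ x)) atTop (𝓝 0) := by
  have hψ : ∀ n y, HasFDerivAt (fun y => φ (y + (u n - x)) - φ y) (φ' (y + (u n - x)) - φ' y) y :=
    fun n y => by
      refine HasFDerivAt.sub ?_ (hderiv y)
      exact (hderiv _).comp y ((hasFDerivAt_id y).add_const (u n - x))
  choose t ht htn using fun n => exists_fderiv_eq_sub (hψ n) x a
  have heq : (fun n => (φ (u n + a) - φ (x + a)) - (φ (u n) - φ x)) =
      fun n => φ' (u n + t n • a) a - φ' (x + t n • a) a := by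
    ext n
    have := htn n
    simp only [_root_.sub_apply] at this
    rw [show x + t n • a + (u n - x) = u n + t n • a by abel,
      show x + a + (u n - x) = u n + a by abel, show x + (u n - x) = u n by abel] at this
    exact this.symm
  rw [heq]
  refine tendsto_of_subseq_tendsto fun ns hns => ?_
  obtain ⟨t0, -, ψ, hψ, ht0⟩ := (isCompact_Icc (a := (0 : ℝ)) (b := 1)).tendsto_subseq
    (fun n => Ioo_subset_Icc_self (ht (ns n)))
  refine ⟨ψ, ?_⟩
  have h1 : WeakConv (fun n => u (ns (ψ n)) + t (ns (ψ n)) • a) (x + t0 • a) := fun w => by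
    simp only [inner_add_left, inner_smul_left]
    exact ((hu w).comp (hns.comp hψ.tendsto_atTop)).add (ht0.mul_const _)
  have h2 : WeakConv (fun n => x + t (ns (ψ n)) • a) (x + t0 • a) := fun w => by
    simp only [inner_add_left, inner_smul_left]
    exact tendsto_const_nhds.add (ht0.mul_const _)
  simpa using (hwsc _ _ h1 a).sub (hwsc _ _ h2 a)

end MeanValue

namespace FountainSetup

variable {X : Type*} [NormedAddCommGroup X] [InnerProductSpace ℝ X] [CompleteSpace X]
variable (S : FountainSetup X)

theorem inner_P_e (u : X) (j : ℕ) : ⟪S.P u, S.e j⟫ = ⟪u, S.e j⟫ := by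
  conv_rhs => rw [← S.P_add_Q u]
  rw [inner_add_left, Submodule.inner_left_of_mem_orthogonal (S.e_mem j) (S.Q_mem u), add_zero]

theorem abs_inner_P_e_le (u : X) (j : ℕ) : |⟪S.P u, S.e j⟫| ≤ ‖u‖ := by
  rw [inner_P_e]
  refine (abs_real_inner_le_norm _ _).trans ?_
  rw [S.orth_e.1, mul_one]

theorem tauTerm_le {R : ℝ} {u : X} (hu : ‖u‖ ≤ R) (j : ℕ) :
    (1 / 2 : ℝ) ^ (j + 1) * |⟪S.P u, S.e j⟫| ≤ (1 / 2 : ℝ) ^ (j + 1) * R :=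
  mul_le_mul_of_nonneg_left ((S.abs_inner_P_e_le u j).trans hu) (by positivity)

theorem summable_geometric_mul (R : ℝ) : Summable fun j : ℕ => (1 / 2 : ℝ) ^ (j + 1) * R :=
  ((summable_nat_add_iff 1).2 summable_geometric_two).mul_right R

theorem summable_tauTerm (u : X) :
    Summable fun j : ℕ => (1 / 2 : ℝ) ^ (j + 1) * |⟪S.P u, S.e j⟫| :=
  Summable.of_nonneg_of_le (fun j => by positivity) (S.tauTerm_le le_rfl)
    (summable_geometric_mul ‖u‖)

theorem tauNorm_zero : S.tauNorm 0 = 0 := by simp [tauNorm]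

theorem tauNorm_add_le (u v : X) : S.tauNorm (u + v) ≤ S.tauNorm u + S.tauNorm v := by
  refine max_le ?_ ?_
  · refine le_trans ?_ (add_le_add (le_max_left _ _) (le_max_left _ _))
    rw [← (S.summable_tauTerm u).tsum_add (S.summable_tauTerm v)]
    refine (S.summable_tauTerm (u + v)).tsum_le_tsum (fun j => ?_)
      ((S.summable_tauTerm u).add (S.summable_tauTerm v))
    rw [← mul_add, map_add, inner_add_left]
    exact mul_le_mul_of_nonneg_left (abs_add_le _ _) (by positivity)
  · refine le_trans ?_ (add_le_add (le_max_right _ _) (le_max_right _ _))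
    rw [map_add]
    exact norm_add_le _ _

theorem exists_tauNorm_le (R : ℝ) : ∃ C, ∀ u : X, ‖u‖ ≤ R → S.tauNorm u ≤ C := by
  refine ⟨max (∑' j : ℕ, (1 / 2 : ℝ) ^ (j + 1) * R) (‖S.Q‖ * R), fun u hu => ?_⟩
  refine max_le_max ?_ (S.Q.le_opNorm_of_le hu)
  exact (S.summable_tauTerm u).tsum_le_tsum (S.tauTerm_le hu) (summable_geometric_mul R)

theorem tauTendsto_of_weakConv {u : ℕ → X} {x : X} (hu : WeakConv u x) {R : ℝ}
    (hR : ∀ n, ‖u n‖ ≤ R) (hQ : Tendsto (fun n => S.Q (u n)) atTop (𝓝 (S.Q x))) :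
    S.TauTendsto u x := by
  have h1 : Tendsto (fun n => ∑' j : ℕ, (1 / 2 : ℝ) ^ (j + 1) * |⟪S.P (u n - x), S.e j⟫|) atTop
      (𝓝 (∑' _ : ℕ, (0 : ℝ))) := by
    refine tendsto_tsum_of_dominated_convergence (summable_geometric_mul (R + ‖x‖))
      (fun j => ?_) (Eventually.of_forall fun n j => ?_)
    · have := ((hu (S.e j)).sub_const ⟪x, S.e j⟫).abs.const_mul ((1 / 2 : ℝ) ^ (j + 1))
      simpa only [inner_P_e, inner_sub_left, sub_self, abs_zero, mul_zero] using this
    · rw [Real.norm_of_nonneg (by positivity)]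
      exact S.tauTerm_le ((norm_sub_le _ _).trans (add_le_add_left (hR n) _)) j
  have h2 : Tendsto (fun n => ‖S.Q (u n - x)‖) atTop (𝓝 0) := by
    simpa [map_sub] using (hQ.sub_const (S.Q x)).norm
  simpa [TauTendsto, tauNorm] using h1.max h2

/-- A functional bounded on `τ`-balls whose derivative is weakly sequentially continuous
is sequentially upper semicontinuous along bounded `τ`-convergent sequences. -/
theorem le_of_weakConv {φ : X → ℝ} {φ' : X → X →L[ℝ] ℝ}
    (hderiv : ∀ u, HasFDerivAt φ (φ' u) u) (hwsc : WeaklySeqContDeriv φ')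
    (hA4 : ∀ δ : ℝ, 0 < δ → ∃ C : ℝ, ∀ u : X, S.tauNorm u < δ → φ u ≤ C)
    {u : ℕ → X} {x : X} (hu : WeakConv u x) {R : ℝ} (hR : ∀ n, ‖u n‖ ≤ R)
    (hQ : Tendsto (fun n => S.Q (u n)) atTop (𝓝 (S.Q x))) {c : ℝ} (hc : ∀ n, c ≤ φ (u n)) :
    c ≤ φ x := by
  by_contra! hlt
  set ε := c - φ x with hε
  have hε0 : 0 < ε := sub_pos.2 hlt
  have hτ : Tendsto (fun n => S.tauNorm (u n - x)) atTop (𝓝 0) := S.tauTendsto_of_weakConv hu hR hQ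
  have hstep : ∀ m : ℕ, ∃ a, S.tauNorm a + (1 / 2 : ℝ) ^ m ≤ 1 ∧ φ x + m * (ε / 2) ≤ φ (x + a) := by
    intro m
    induction m with
    | zero => exact ⟨0, by simp [S.tauNorm_zero], by simp⟩
    | succ m ih =>
      obtain ⟨a, ha, hφa⟩ := ih
      obtain ⟨n, hn1, hn2⟩ := ((hτ.eventually_lt_const (u := (1 / 2 : ℝ) ^ (m + 1))
        (by positivity)).and ((hu.tendsto_sub_sub hderiv hwsc a).eventually_const_lt
        (u := -(ε / 2)) (by linarith))).exists
      refine ⟨a + (u n - x), ?_, ?_⟩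
      · have := S.tauNorm_add_le a (u n - x)
        rw [pow_succ] at hn1 ⊢
        linarith
      · rw [show x + (a + (u n - x)) = u n + a by abel]
        have := hc n
        push_cast
        linarith
  have hx : 0 ≤ S.tauNorm x := le_max_of_le_right (norm_nonneg _)
  obtain ⟨C, hC⟩ := hA4 (S.tauNorm x + 2) (by linarith)
  obtain ⟨m, hm⟩ := exists_nat_gt ((C - φ x) / (ε / 2))
  rw [div_lt_iff₀ (by linarith)] at hm
  obtain ⟨a, ha, hφa⟩ := hstep m
  have h2 : 0 < (1 / 2 : ℝ) ^ m := by positivity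
  have := hC (x + a) (by linarith [S.tauNorm_add_le x a])
  linarith

end FountainSetup

/-- The sequential form of upper semicontinuity along a map. -/
theorem eventually_lt_of_seq {B : Type*} [TopologicalSpace B] [FirstCountableTopology B]
    {F : B → ℝ} {x : B} {M : ℝ} (h : ∀ u : ℕ → B, Tendsto u atTop (𝓝 x) → (∀ n, M ≤ F (u n)) →
      M ≤ F x) (hx : F x < M) : ∀ᶠ y in 𝓝 x, F y < M := by
  by_contra hcon
  obtain ⟨u, hu, hM⟩ := exists_seq_forall_of_frequently (not_eventually.1 hcon)
  exact (h u hu fun n => not_lt.1 (hM n)).not_gt hx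

theorem eventually_lt_fderiv {B X : Type*} [TopologicalSpace B] [FirstCountableTopology B]
    [NormedAddCommGroup X] [InnerProductSpace ℝ X] {φ' : X → X →L[ℝ] ℝ} (hwsc : WeaklySeqContDeriv φ') {γ : B → X}
    (hγ : ∀ (u : ℕ → B) (x : B), Tendsto u atTop (𝓝 x) → WeakConv (fun n => γ (u n)) (γ x))
    {x : B} {w : X} {β : ℝ} (hβ : β < φ' (γ x) w) :
    ∃ s > 0, ∀ᶠ y in 𝓝 x, ∀ v ∈ closedBall (γ y) s, β < φ' v w := by
  have h : ∀ᶠ p : B × X in 𝓝 x ×ˢ 𝓝 0, β < φ' (γ p.1 + p.2) w := by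
    by_contra hcon
    obtain ⟨u, hu, hle⟩ := exists_seq_forall_of_frequently (not_eventually.1 hcon)
    have h1 := hγ _ x (tendsto_fst.comp hu)
    have h2 : Tendsto (fun n => (u n).2) atTop (𝓝 0) := tendsto_snd.comp hu
    have h3 : WeakConv (fun n => γ (u n).1 + (u n).2) (γ x) := fun z => by
      have := (h1 z).add (h2.inner (tendsto_const_nhds (x := z)))
      simpa [inner_add_left] using this
    exact (le_of_tendsto (hwsc _ _ h3 w) (Eventually.of_forall fun n => not_lt.1 (hle n))).not_gt hβ
  obtain ⟨p, hp, q, hq, hpq⟩ := eventually_prod_iff.1 h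
  obtain ⟨s, hs, hsq⟩ := Metric.nhds_basis_closedBall.eventually_iff.1 hq
  refine ⟨s, hs, hp.mono fun y hy v hv => ?_⟩
  have := hpq hy (hsq (x := v - γ y) (by rwa [mem_closedBall_zero_iff, ← dist_eq_norm]))
  simpa using this

/-- An odd pseudo-gradient field along a compact weakly continuous odd map. -/
theorem exists_odd_pseudogradient {B X : Type*} [TopologicalSpace B] [CompactSpace B]
    [TopologicalSpace.MetrizableSpace B] [InvolutiveNeg B] [ContinuousNeg B]
    [NormedAddCommGroup X] [InnerProductSpace ℝ X] {φ : X → ℝ} {φ' : X → X →L[ℝ] ℝ}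
    (hodd' : ∀ u w, φ' (-u) w = -φ' u w)
    (heven : ∀ u, φ (-u) = φ u)
    (hwsc : WeaklySeqContDeriv φ') {γ : B → X}
    (hγ : ∀ (u : ℕ → B) (x : B), Tendsto u atTop (𝓝 x) → WeakConv (fun n => γ (u n)) (γ x))
    (hγodd : ∀ x, γ (-x) = -γ x) {M β : ℝ} (hβ : 0 < β)
    (husc : ∀ (u : ℕ → B) (x : B), Tendsto u atTop (𝓝 x) → (∀ n, M ≤ φ (γ (u n))) → M ≤ φ (γ x))
    (hreg : ∀ x, M ≤ φ (γ x) → ∃ w, ‖w‖ ≤ 1 ∧ β < φ' (γ x) w) :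
    ∃ V : C(B, X), (∀ x, V (-x) = -V x) ∧ (∀ x, ‖V x‖ ≤ 1) ∧ ∃ s > 0, ∀ x,
      ∀ v ∈ closedBall (γ x) s, 0 ≤ φ' v (V x) ∧ (M ≤ φ (γ x) → β ≤ φ' v (V x)) := by
  have hloc : ∀ x, ∃ w, ‖w‖ ≤ 1 ∧ ∃ s > 0, ∀ᶠ y in 𝓝 x, ∀ v ∈ closedBall (γ y) s,
      0 ≤ φ' v w ∧ (M ≤ φ (γ y) → β ≤ φ' v w) := fun x => by
    rcases lt_or_ge (φ (γ x)) M with hM | hM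
    · refine ⟨0, by simp, 1, one_pos, ?_⟩
      filter_upwards [eventually_lt_of_seq (F := fun y => φ (γ y)) (fun u => husc u x) hM]
        with y hy v _
      exact ⟨by simp, fun h => absurd h hy.not_ge⟩
    · obtain ⟨w, hw, hβw⟩ := hreg x hM
      obtain ⟨s, hs, hsw⟩ := eventually_lt_fderiv hwsc hγ hβw
      exact ⟨w, hw, s, hs, hsw.mono fun y hy v hv => ⟨(hβ.trans (hy v hv)).le, fun _ =>
        (hy v hv).le⟩⟩
  obtain ⟨s, hs, hsw⟩ : ∃ s > 0, ∀ x ∈ (univ : Set B), ∃ w, ‖w‖ ≤ 1 ∧ ∀ᶠ y in 𝓝 x,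
      ∀ v ∈ closedBall (γ y) s, 0 ≤ φ' v w ∧ (M ≤ φ (γ y) → β ≤ φ' v w) := by
    refine isCompact_univ.induction_on (p := fun A => ∃ s > 0, ∀ x ∈ A, ∃ w, ‖w‖ ≤ 1 ∧
      ∀ᶠ y in 𝓝 x, ∀ v ∈ closedBall (γ y) s, 0 ≤ φ' v w ∧ (M ≤ φ (γ y) → β ≤ φ' v w))
      ⟨1, one_pos, by simp⟩ ?_ ?_ ?_
    · rintro A A' hA ⟨s, hs, h⟩
      exact ⟨s, hs, fun x hx => h x (hA hx)⟩
    · rintro A A' ⟨s, hs, h⟩ ⟨s', hs', h'⟩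
      refine ⟨min s s', lt_min hs hs', fun x hx => ?_⟩
      rcases hx with hx | hx
      · obtain ⟨w, hw, hev⟩ := h x hx
        exact ⟨w, hw, hev.mono fun y hy v hv =>
          hy v (closedBall_subset_closedBall (min_le_left _ _) hv)⟩
      · obtain ⟨w, hw, hev⟩ := h' x hx
        exact ⟨w, hw, hev.mono fun y hy v hv =>
          hy v (closedBall_subset_closedBall (min_le_right _ _) hv)⟩
    · intro x _
      obtain ⟨w, hw, s, hs, hev⟩ := hloc x
      exact ⟨_, mem_nhdsWithin_of_mem_nhds (eventually_eventually_nhds.2 hev),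
        s, hs, fun y hy => ⟨w, hw, hy⟩⟩
  obtain ⟨g, hg⟩ := exists_continuous_forall_mem_convex_of_local_const
    (t := fun x => {w | ‖w‖ ≤ 1 ∧ ∀ v ∈ closedBall (γ x) s, 0 ≤ φ' v w ∧
      (M ≤ φ (γ x) → β ≤ φ' v w)})
    (fun x => by
      rintro w ⟨hw, hwv⟩ w' ⟨hw', hwv'⟩ a b ha hb hab
      refine ⟨?_, fun v hv => ⟨?_, fun hM => ?_⟩⟩
      · refine (norm_add_le _ _).trans ?_
        rw [norm_smul, norm_smul, Real.norm_of_nonneg ha, Real.norm_of_nonneg hb]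
        nlinarith
      · simp only [map_add, map_smul, smul_eq_mul]
        exact add_nonneg (mul_nonneg ha (hwv v hv).1) (mul_nonneg hb (hwv' v hv).1)
      · simp only [map_add, map_smul, smul_eq_mul]
        have := mul_le_mul_of_nonneg_left ((hwv v hv).2 hM) ha
        have := mul_le_mul_of_nonneg_left ((hwv' v hv).2 hM) hb
        have : β = a * β + b * β := by rw [← add_mul, hab, one_mul]
        linarith)
    (fun x => by
      obtain ⟨w, hw, hev⟩ := hsw x (mem_univ x)
      exact ⟨w, hev.mono fun y hy => ⟨hw, hy⟩⟩)
  refine ⟨⟨fun x => (1 / 2 : ℝ) • (g x - g (-x)), ?_⟩, fun x => ?_, fun x => ?_, s, hs,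
    fun x v hv => ?_⟩
  · exact (g.continuous.sub (g.continuous.comp continuous_neg)).const_smul _
  · simp only [ContinuousMap.coe_mk, neg_neg]
    rw [← smul_neg, neg_sub]
  · simp only [ContinuousMap.coe_mk]
    rw [norm_smul, Real.norm_of_nonneg (by norm_num)]
    have := (hg x).1
    have := (hg (-x)).1
    linarith [norm_sub_le (g x) (g (-x))]
  · have hv' : -v ∈ closedBall (γ (-x)) s := by
      rwa [hγodd, mem_closedBall, dist_neg_neg]
    have h1 := (hg x).2 v hv
    have h2 := (hg (-x)).2 (-v) hv'
    rw [hodd', hγodd, heven] at h2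
    simp only [ContinuousMap.coe_mk, map_smul, map_sub, smul_eq_mul]
    refine ⟨by linarith [h1.1, h2.1], fun hM => ?_⟩
    linarith [h1.2 hM, h2.2 hM]

/-- A maximality principle for curves of bounded speed in a closed set of maps. -/
theorem exists_maximal_speed_one {B X : Type*} [TopologicalSpace B] [CompactSpace B]
    [NormedAddCommGroup X] [CompleteSpace X] {A : Set (ℝ × C(B, X))} (hA : IsClosed A)
    (hne : A.Nonempty) {T : ℝ} (hT : ∀ p ∈ A, p.1 ≤ T) :
    ∃ p ∈ A, ∀ q ∈ A, dist p.2 q.2 ≤ q.1 - p.1 → q.1 ≤ p.1 := by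
  suffices h : ∃ p : A, ∀ q : A, dist p.1.2 q.1.2 ≤ q.1.1 - p.1.1 →
      dist q.1.2 p.1.2 ≤ p.1.1 - q.1.1 by
    obtain ⟨p, hp⟩ := h
    refine ⟨p.1, p.2, fun q hq hpq => ?_⟩
    have := hp ⟨q, hq⟩ hpq
    linarith [dist_nonneg.trans this]
  refine exists_maximal_of_chains_bounded
    (r := fun p q : A => dist p.1.2 q.1.2 ≤ q.1.1 - p.1.1) (fun c hc => ?_) ?_
  · rcases c.eq_empty_or_nonempty with rfl | hcne
    · exact ⟨⟨_, hne.some_mem⟩, by simp⟩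
    have hcmp : ∀ p ∈ c, ∀ q ∈ c, dist p.1.2 q.1.2 ≤ |q.1.1 - p.1.1| := fun p hp q hq => by
      by_cases hpq : p = q
      · simp [hpq]
      rcases hc hp hq hpq with h | h
      · exact h.trans (le_abs_self _)
      · rw [dist_comm, abs_sub_comm]
        exact h.trans (le_abs_self _)
    have hbdd : BddAbove ((fun p : A => p.1.1) '' c) :=
      ⟨T, by rintro _ ⟨p, -, rfl⟩; exact hT _ p.2⟩
    obtain ⟨t, -, ht, htc⟩ := exists_seq_tendsto_sSup (hcne.image _) hbdd
    choose p hpc hpt using htc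
    replace hpt : ∀ n, (p n).1.1 = t n := hpt
    set t0 := sSup ((fun p : A => p.1.1) '' c)
    have hcau : CauchySeq fun n => (p n).1.2 := by
      rw [Metric.cauchySeq_iff]
      intro ε hε
      obtain ⟨N, hN⟩ := Metric.cauchySeq_iff.1 ht.cauchySeq ε hε
      refine ⟨N, fun m hm n hn => (hcmp _ (hpc m) _ (hpc n)).trans_lt ?_⟩
      simp only [hpt]
      rw [abs_sub_comm]
      exact hN m hm n hn
    obtain ⟨h, hh⟩ := cauchySeq_tendsto_of_complete hcau
    have hmem : (t0, h) ∈ A := by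
      refine hA.mem_of_tendsto (ht.prodMk_nhds hh) (Eventually.of_forall fun n => ?_)
      rw [← hpt n]
      exact (p n).2
    refine ⟨⟨(t0, h), hmem⟩, fun q hq => ?_⟩
    have hle : q.1.1 ≤ t0 := le_csSup hbdd ⟨q, hq, rfl⟩
    have h1 : dist q.1.2 h ≤ |t0 - q.1.1| :=
      le_of_tendsto_of_tendsto' (tendsto_const_nhds.dist hh) (ht.sub_const q.1.1).abs fun n => by
        have := hcmp q hq _ (hpc n)
        rwa [hpt] at this
    rwa [abs_of_nonneg (sub_nonneg.2 hle)] at h1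
  · intro a b c hab hbc
    linarith [dist_triangle a.1.2 b.1.2 c.1.2]

namespace FountainSetup

variable {B X : Type*} [TopologicalSpace B] [CompactSpace B] [TopologicalSpace.MetrizableSpace B]
  [InvolutiveNeg B] [ContinuousNeg B] [NormedAddCommGroup X] [InnerProductSpace ℝ X]
  [CompleteSpace X] {φ : X → ℝ} {φ' : X → X →L[ℝ] ℝ}

/-- An odd compact perturbation pushing a compact weakly continuous odd family below a
level above which the functional has no small derivative. -/
theorem exists_odd_deformation (S : FountainSetup X) (hderiv : ∀ u, HasFDerivAt φ (φ' u) u)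
    (heven : ∀ u, φ (-u) = φ u) (hwsc : WeaklySeqContDeriv φ')
    (hA4 : ∀ δ : ℝ, 0 < δ → ∃ C : ℝ, ∀ u : X, S.tauNorm u < δ → φ u ≤ C) {ι : B → X}
    (hι : ∀ (u : ℕ → B) (x : B), Tendsto u atTop (𝓝 x) → WeakConv (fun n => ι (u n)) (ι x))
    {R : ℝ} (hR : ∀ x, ‖ι x‖ ≤ R) (hQ : Continuous fun x => S.Q (ι x))
    (hιodd : ∀ x, ι (-x) = -ι x) {M d β : ℝ} (hβ : 0 < β) (hd : ∀ x, φ (ι x) ≤ d)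
    (hreg : ∀ u, M ≤ φ u → φ u ≤ d → ∃ w, ‖w‖ ≤ 1 ∧ β < φ' u w) :
    ∃ h : C(B, X), (∀ x, h (-x) = -h x) ∧ (∀ x, φ (ι x + h x) ≤ φ (ι x)) ∧
      ∀ x, φ (ι x + h x) ≤ M := by
  have hφc : Continuous φ := continuous_iff_continuousAt.2 fun u => (hderiv u).continuousAt
  have hodd' : ∀ u w, φ' (-u) w = -φ' u w := fun u w => by
    have h1 : HasFDerivAt φ (-φ' (-u)) u := by
      have h2 := (hderiv (-u)).comp u (hasFDerivAt_id u).neg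
      have h3 : (φ ∘ fun x : X => -x) = φ := funext heven
      rw [ContinuousLinearMap.comp_neg] at h2
      exact h3 ▸ h2
    have := congrArg (fun L : X →L[ℝ] ℝ => L w) (h1.unique (hderiv u))
    simp only [_root_.neg_apply] at this
    linarith
  set T : ℝ := max 0 ((d - M) / β)
  let A : Set (ℝ × C(B, X)) := {p | p.1 ≤ T ∧ (∀ x, p.2 (-x) = -p.2 x) ∧
    (∀ x, φ (ι x + p.2 x) ≤ φ (ι x)) ∧ ∀ x, φ (ι x + p.2 x) ≤ max M (φ (ι x) - β * p.1)}
  have hA : IsClosed A := by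
    have hev : ∀ x : B, Continuous fun p : ℝ × C(B, X) => p.2 x := fun x =>
      (continuous_eval_const x).comp continuous_snd
    have hφev : ∀ x : B, Continuous fun p : ℝ × C(B, X) => φ (ι x + p.2 x) := fun x =>
      hφc.comp (continuous_const.add (hev x))
    have hAeq : A = {p | p.1 ≤ T} ∩ ⋂ x, ({p | p.2 (-x) = -p.2 x} ∩
        ({p | φ (ι x + p.2 x) ≤ φ (ι x)} ∩
          {p | φ (ι x + p.2 x) ≤ max M (φ (ι x) - β * p.1)})) := by
      ext p
      simp only [A, Set.mem_ofPred_eq, Set.mem_inter_iff, Set.mem_iInter, forall_and]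
    rw [hAeq]
    exact (isClosed_le continuous_fst continuous_const).inter (isClosed_iInter fun x =>
      (isClosed_eq (hev _) (hev x).neg).inter ((isClosed_le (hφev x) continuous_const).inter
        (isClosed_le (hφev x) (continuous_const.max
          (continuous_const.sub (continuous_const.mul continuous_fst))))))
  have hne : A.Nonempty := ⟨(0, 0), le_max_left _ _, by simp, by simp, by simp⟩
  obtain ⟨⟨t, h⟩, ⟨htT, hodd, hle, hmax⟩, hpmax⟩ := exists_maximal_speed_one hA hne
    (T := T) fun p hp => hp.1
  simp only at htT hodd hle hmax hpmax
  have htT' : t = T := by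
    refine le_antisymm htT (le_of_not_gt fun hlt => ?_)
    obtain ⟨C, hC⟩ : ∃ C, ∀ x, ‖h x‖ ≤ C := ⟨‖h‖, h.norm_coe_le_norm⟩
    have hγ : ∀ (u : ℕ → B) (x : B), Tendsto u atTop (𝓝 x) →
        WeakConv (fun n => ι (u n) + h (u n)) (ι x + h x) := fun u x hu w => by
      simp only [inner_add_left]
      exact (hι u x hu w).add (((h.continuous.tendsto x).comp hu).inner tendsto_const_nhds)
    obtain ⟨V, hVodd, hV1, s, hs, hV⟩ := exists_odd_pseudogradient (φ := φ) (M := M) hodd' heven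
      hwsc hγ (fun x => by rw [hιodd, hodd, neg_add]) hβ
      (fun u x hu hM => S.le_of_weakConv hderiv hwsc hA4 (hγ u x hu)
        (fun n => (norm_add_le _ _).trans (add_le_add (hR _) (hC _)))
        (by
          simp only [map_add]
          exact ((hQ.tendsto x).comp hu).add
            ((S.Q.continuous.tendsto _).comp ((h.continuous.tendsto x).comp hu))) hM)
      (fun x hx => hreg _ hx ((hle x).trans (hd x)))
    set σ := min s (T - t)
    have hσ : 0 < σ := lt_min hs (sub_pos.2 hlt)
    have hstep : ∀ x, φ (ι x + (h - σ • V) x) ≤ φ (ι x + h x) ∧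
        (M ≤ φ (ι x + h x) → φ (ι x + (h - σ • V) x) ≤ φ (ι x + h x) - β * σ) := fun x => by
      obtain ⟨τ, hτ, heq⟩ := exists_fderiv_eq_sub hderiv (ι x + h x) (-(σ • V x))
      rw [show ι x + h x + -(σ • V x) = ι x + (h - σ • V) x by simp; abel] at heq
      have hmem : ι x + h x + τ • -(σ • V x) ∈ closedBall (ι x + h x) s := by
        rw [mem_closedBall, dist_eq_norm, add_sub_cancel_left, norm_smul, norm_neg, norm_smul,
          Real.norm_of_nonneg hτ.1.le, Real.norm_of_nonneg hσ.le]
        calc τ * (σ * ‖V x‖) ≤ 1 * (σ * 1) := by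
              gcongr
              · exact hτ.2.le
              · exact hV1 x
          _ ≤ s := by rw [one_mul, mul_one]; exact min_le_left _ _
      have hVx := hV x _ hmem
      rw [map_neg, map_smul, smul_eq_mul] at heq
      refine ⟨?_, fun hM => ?_⟩
      · linarith [mul_nonneg hσ.le hVx.1]
      · linarith [mul_le_mul_of_nonneg_left (hVx.2 hM) hσ.le]
    have hq : (t + σ, h - σ • V) ∈ A := by
      refine ⟨?_, fun x => ?_, fun x => (hstep x).1.trans (hle x), fun x => ?_⟩
      · have : σ ≤ T - t := min_le_right _ _
        simp only
        linarith
      · simp [hodd, hVodd]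
        abel
      · simp only
        rcases le_or_gt M (φ (ι x + h x)) with hM | hM
        · have h1 := (hstep x).2 hM
          rcases le_max_iff.1 (hmax x) with h2 | h2
          · exact le_max_of_le_left ((hstep x).1.trans h2)
          · refine le_max_of_le_right ?_
            linarith
        · exact le_max_of_le_left ((hstep x).1.trans hM.le)
    have := hpmax _ hq (by
      rw [ContinuousMap.dist_le (by simpa using hσ.le)]
      intro x
      rw [dist_eq_norm]
      simp only [ContinuousMap.sub_apply, ContinuousMap.smul_apply, sub_sub_cancel,
        add_sub_cancel_left, norm_smul, Real.norm_of_nonneg hσ.le]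
      exact mul_le_of_le_one_right hσ.le (hV1 x))
    simp only at this
    linarith
  refine ⟨h, hodd, hle, fun x => (hmax x).trans (max_le le_rfl ?_)⟩
  have h1 : (d - M) / β ≤ t := htT' ▸ le_max_right _ _
  rw [div_le_iff₀ hβ] at h1
  linarith [hd x]

end FountainSetup

namespace FountainSetup

variable {X : Type*} [NormedAddCommGroup X] [InnerProductSpace ℝ X] [CompleteSpace X]
variable (S : FountainSetup X)

theorem Q_eq_zero_of_mem_Y {y : X} (hy : y ∈ S.Y) : S.Q y = 0 := by
  have h : S.Q y = y - S.P y := eq_sub_of_add_eq' (S.P_add_Q y)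
  refine Submodule.disjoint_def.1 S.Y.orthogonal_disjoint _ ?_ (S.Q_mem y)
  rw [h]
  exact S.Y.sub_mem hy (S.P_mem y)

theorem Q_eq_self_of_mem_orthogonal {z : X} (hz : z ∈ S.Yᗮ) : S.Q z = z := by
  have h : S.P z = z - S.Q z := eq_sub_of_add_eq (S.P_add_Q z)
  have h0 : S.P z = 0 := by
    refine Submodule.disjoint_def.1 S.Y.orthogonal_disjoint _ (S.P_mem z) ?_
    rw [h]
    exact Submodule.sub_mem _ hz (S.Q_mem z)
  rw [h0] at h
  exact (sub_eq_zero.1 h.symm).symm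

theorem Q_eq_sum_of_mem_Yk {k : ℕ} {u : X} (hu : u ∈ S.Yk k) :
    S.Q u = ∑ j ∈ Finset.range (k + 1), ⟪u, S.f j⟫ • S.f j := by
  let L : X →ₗ[ℝ] X :=
    ∑ j ∈ Finset.range (k + 1), (innerₗ X (S.f j)).smulRight (S.f j)
  have hL : ∀ u, L u = ∑ j ∈ Finset.range (k + 1), ⟪u, S.f j⟫ • S.f j := fun u => by
    simp [L, real_inner_comm]
  have hle : S.Yk k ≤ LinearMap.eqLocus (S.Q : X →ₗ[ℝ] X) L := by
    refine sup_le (fun y hy => ?_) (Submodule.span_le.2 ?_)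
    · rw [LinearMap.mem_eqLocus, hL]
      refine (S.Q_eq_zero_of_mem_Y hy).trans (Finset.sum_eq_zero fun j _ => ?_).symm
      rw [Submodule.inner_right_of_mem_orthogonal hy (S.f_mem j), zero_smul]
    · rintro _ ⟨j, hj, rfl⟩
      rw [SetLike.mem_coe, LinearMap.mem_eqLocus, hL]
      refine (S.Q_eq_self_of_mem_orthogonal (S.f_mem j)).trans ?_
      rw [Finset.sum_eq_single_of_mem j (Finset.mem_range.2 (Nat.lt_succ_of_le hj))]
      · rw [real_inner_self_eq_norm_sq, S.orth_f.1, one_pow, one_smul]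
      · intro i _ hi
        rw [S.orth_f.2 hi.symm, zero_smul]
  rw [← hL]
  exact hle hu

theorem continuous_Q_incl (k : ℕ) (ρ : ℝ) :
    Continuous fun x : WeakBall (S.Yk k) ρ => S.Q x.incl := by
  simp only [fun x : WeakBall (S.Yk k) ρ => S.Q_eq_sum_of_mem_Yk x.incl_mem]
  exact continuous_finsetSum _ fun j _ =>
    (WeakBall.continuous_inner (S.f j)).smul continuous_const

end FountainSetup

/-- **Improved fountain theorem (Theorem 1.2).**  Let `φ ∈ C¹(X, ℝ)` be even, satisfying the
`(PS)^c` condition for every `c`, with `∇φ` weakly sequentially continuous.  If for every `k`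
there are `ρ_k > r_k > 0` such that `(A₁)`, `(A₂)'`, `(A₃)`, `(A₄)` hold, then `φ` has a
sequence of critical points whose norms tend to infinity. -/
theorem improved_fountain_theorem
    {X : Type*} [NormedAddCommGroup X] [InnerProductSpace ℝ X] [CompleteSpace X]
    (S : FountainSetup X) (φ : X → ℝ) (φ' : X → X →L[ℝ] ℝ)
    -- φ ∈ C¹(X, ℝ)
    (hderiv : ∀ u, HasFDerivAt φ (φ' u) u) (hC1 : Continuous φ')
    -- φ is even
    (heven : ∀ u, φ (-u) = φ u)
    -- ∇φ is weakly sequentially continuous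
    (hwsc : WeaklySeqContDeriv φ')
    -- (PS)^c condition for every c < ∞ : every sequence with sup_n φ(u_n) ≤ c and
    -- φ'(u_n) → 0 in X' has a convergent subsequence
    (hPS : ∀ c : ℝ, ∀ u : ℕ → X, (∀ n, φ (u n) ≤ c) →
      Tendsto (fun n => ‖φ' (u n)‖) atTop (𝓝 0) →
      ∃ ψ : ℕ → ℕ, StrictMono ψ ∧ ∃ v : X, Tendsto (fun n => u (ψ n)) atTop (𝓝 v))
    (ρ r : ℕ → ℝ) (hr : ∀ k, 0 < r k) (hρr : ∀ k, r k < ρ k)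
    -- (A₁) : d_k = sup {φ(u) : u ∈ Y_k, ‖u‖ ≤ ρ_k} < ∞
    (hA1 : ∀ k, ∃ d : ℝ, ∀ u ∈ S.Yk k, ‖u‖ ≤ ρ k → φ u ≤ d)
    -- (A₂)' : a_k = sup {φ(u) : u ∈ Y_k, ‖u‖ = ρ_k} < inf {φ(u) : u ∈ Z_k, ‖u‖ ≤ r_k}
    (hA2' : ∀ k, ∃ a b : ℝ, a < b ∧ (∀ u ∈ S.Yk k, ‖u‖ = ρ k → φ u ≤ a) ∧
      (∀ u ∈ S.Zk k, ‖u‖ ≤ r k → b ≤ φ u))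
    -- (A₃) : b_k = inf {φ(u) : u ∈ Z_k, ‖u‖ = r_k} → ∞ as k → ∞
    (hA3 : ∀ M : ℝ, ∃ K : ℕ, ∀ k ≥ K, ∀ u ∈ S.Zk k, ‖u‖ = r k → M ≤ φ u)
    -- (A₄) : for every δ > 0, sup {φ(u) : ‖u‖_τ < δ} ≤ C_δ < ∞
    (hA4 : ∀ δ : ℝ, 0 < δ → ∃ C : ℝ, ∀ u : X, S.tauNorm u < δ → φ u ≤ C) :
    -- φ has a sequence of critical points with norms tending to infinity
    ∃ u : ℕ → X, (∀ m, φ' (u m) = 0) ∧ Tendsto (fun m => ‖u m‖) atTop atTop := by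
  by_contra hcon
  have hφc : Continuous φ := continuous_iff_continuousAt.2 fun u => (hderiv u).continuousAt
  obtain ⟨R, hR⟩ : ∃ R : ℝ, ∀ u, φ' u = 0 → ‖u‖ ≤ R := by
    by_contra! h
    choose u hu hnorm using fun n : ℕ => h n
    exact hcon ⟨u, hu, tendsto_atTop_mono (fun n => (hnorm n).le) tendsto_natCast_atTop_atTop⟩
  obtain ⟨C, hC⟩ := S.exists_tauNorm_le R
  obtain ⟨M, hM⟩ := hA4 (max C 0 + 1) (by positivity)
  have hcrit : ∀ u, φ' u = 0 → φ u ≤ M := fun u hu =>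
    hM u (((hC u (hR u hu)).trans (le_max_left _ _)).trans_lt (lt_add_one _))
  obtain ⟨k, hk⟩ := hA3 (M + 2)
  replace hk := hk k le_rfl
  obtain ⟨d, hd⟩ := hA1 k
  obtain ⟨a, b, hab, ha, hb⟩ := hA2' k
  obtain ⟨δ, hδ, hδφ⟩ : ∃ δ > 0, ∀ u, M + 1 ≤ φ u → φ u ≤ d → δ ≤ ‖φ' u‖ := by
    by_contra! h
    choose u hu hud huφ using fun n : ℕ => h (1 / ((n : ℝ) + 1)) (by positivity)
    have h0 : Tendsto (fun n => ‖φ' (u n)‖) atTop (𝓝 0) :=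
      squeeze_zero (fun _ => norm_nonneg _) (fun n => (huφ n).le)
        tendsto_one_div_add_atTop_nhds_zero_nat
    obtain ⟨ψ, hψ, v, hv⟩ := hPS d u hud h0
    have hv0 : φ' v = 0 := norm_eq_zero.1 <| tendsto_nhds_unique
      ((hC1.tendsto v).comp hv).norm (h0.comp hψ.tendsto_atTop)
    have hv1 : M + 1 ≤ φ v := ge_of_tendsto' ((hφc.tendsto v).comp hv) fun n => hu _
    linarith [hcrit v hv0]
  have hreg : ∀ u, M + 1 ≤ φ u → φ u ≤ d → ∃ w, ‖w‖ ≤ 1 ∧ δ / 2 < φ' u w := fun u h1 h2 => by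
    obtain ⟨w, hw, hlt⟩ := (φ' u).exists_lt_apply_of_lt_opNorm
      ((half_lt_self hδ).trans_le (hδφ u h1 h2))
    rcases lt_abs.1 hlt with h | h
    · exact ⟨w, hw.le, h⟩
    · exact ⟨-w, by rw [norm_neg]; exact hw.le, by rwa [map_neg]⟩
  have := S.separable
  have := WeakBall.compactSpace (ρ := ρ k) (S.isClosed_Yk k)
  have := WeakBall.metrizableSpace (V := S.Yk k) (ρ := ρ k)
  obtain ⟨h, hodd, hle, hhM⟩ := S.exists_odd_deformation hderiv heven hwsc hA4
    (ι := fun x : WeakBall (S.Yk k) (ρ k) => x.incl) (fun _ _ hu => WeakBall.weakConv hu)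
    WeakBall.norm_incl_le (S.continuous_Q_incl k (ρ k)) WeakBall.incl_neg (half_pos hδ)
    (fun x => hd _ x.incl_mem x.norm_incl_le) hreg
  obtain ⟨x, hxZ, hx | ⟨hxr, hxρ⟩⟩ := S.exists_mem_Zk_of_odd k (hr k) (hρr k) h.continuous hodd
  · linarith [hk _ hxZ hx, hhM x]
  · linarith [hb _ hxZ hxr, hle x, ha _ x.incl_mem hxρ]

end
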